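/- arXiv:2506.13962 — 2 statements merged into one kernel-verified Lean document; each statement's English description precedes it below -/
import Mathlib

section
/- There exist constants m and C such that for every integer k ≥ 1 there exist a natural number n ≤ 2k + C·(Nat.log 2 (2k + 1) + 1), a set A of m partial transformations of an n-element set, and a partial transformation f expressed by some nonempty word over A, such that the depth of f with respect to A is at least binom(2k, k) · g(k), where g(k) is the maximum order of a permutation of a k-element set. In particular, for this constant m the maximum diameter of sets of m partial transformations of n-element sets grows as 2^n · e^((1+o(1))·sqrt((n/2)·log n)). -/
/-- Applying a word (list) of partial transformations of `Fin n` to a state `q`,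
composing from left to right, with `none` (undefined) propagating. -/
def ptApply {n : ℕ} (w : List (Fin n → Option (Fin n))) (q : Fin n) : Option (Fin n) :=
  w.foldl (fun o f => o.bind f) (some q)

/-- A nonempty word `w` over the alphabet `A` expresses the partial transformation `f`. -/
def Expresses {n : ℕ} (A : Finset (Fin n → Option (Fin n)))
    (w : List (Fin n → Option (Fin n))) (f : Fin n → Option (Fin n)) : Prop :=
  w ≠ [] ∧ (∀ g ∈ w, g ∈ A) ∧ (fun q => ptApply w q) = f

/-- The Landau function: the maximum order of a permutation of a `k`-element set. -/
noncomputable def landau (k : ℕ) : ℕ :=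
  Finset.univ.sup fun σ : Equiv.Perm (Fin k) => orderOf σ

namespace Diam

/-! ### Part 1: transfer from an abstract machine to partial transformations of `Fin n` -/

/-- Run a word of letters acting on `Q`. -/
def runL {Λ Q : Type*} (act : Λ → Q → Option Q) (w : List Λ) (q : Q) : Option Q :=
  w.foldl (fun o l => o.bind (act l)) (some q)

lemma foldl_none {Λ Q : Type*} (act : Λ → Q → Option Q) (w : List Λ) :
    w.foldl (fun o l => o.bind (act l)) none = none := by
  induction w with
  | nil => rfl
  | cons a w ih => simpa using ih

lemma runL_cons {Λ Q : Type*} (act : Λ → Q → Option Q) (l : Λ) (w : List Λ) (q : Q) :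
    runL act (l :: w) q = (act l q).bind (runL act w) := by
  unfold runL
  rw [List.foldl_cons]
  cases h : act l q with
  | none => simp [h, foldl_none]
  | some x => simp [h]

/-- Runs of an abstract step relation. -/
def Run {Λ Cfg : Type*} (step : Λ → Cfg → Cfg → Prop) : List Λ → Cfg → Cfg → Prop
  | [], c, c' => c = c'
  | l :: w, c, c' => ∃ d, step l c d ∧ Run step w d c'

lemma Run.append {Λ Cfg : Type*} {step : Λ → Cfg → Cfg → Prop} {w v : List Λ} {a b c : Cfg}
    (h1 : Run step w a b) (h2 : Run step v b c) : Run step (w ++ v) a c := by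
  induction w generalizing a with
  | nil => cases h1; exact h2
  | cons l w ih =>
    obtain ⟨d, hd, h⟩ := h1
    exact ⟨d, hd, ih h⟩

lemma run_runL {Λ Q Tok Cfg : Type*} (act : Λ → Q → Option Q) (posOf : Cfg → Tok → Q)
    (step : Λ → Cfg → Cfg → Prop)
    (h1 : ∀ l c c', step l c c' → ∀ k, act l (posOf c k) = some (posOf c' k))
    {w : List Λ} {c c' : Cfg} (h : Run step w c c') (k : Tok) :
    runL act w (posOf c k) = some (posOf c' k) := by
  induction w generalizing c with
  | nil => cases h; rfl
  | cons l w ih =>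
    obtain ⟨d, hd, h⟩ := h
    rw [runL_cons, h1 _ _ _ hd k]
    exact ih h

lemma runL_run {Λ Q Tok Cfg : Type*} (act : Λ → Q → Option Q) (posOf : Cfg → Tok → Q)
    (step : Λ → Cfg → Cfg → Prop)
    (h1 : ∀ l c c', step l c c' → ∀ k, act l (posOf c k) = some (posOf c' k))
    (h2 : ∀ l c, (∀ k, act l (posOf c k) ≠ none) → ∃ c', step l c c')
    (hinj : ∀ c c', (∀ k, posOf c k = posOf c' k) → c = c')
    {w : List Λ} {c c' : Cfg} (h : ∀ k, runL act w (posOf c k) = some (posOf c' k)) :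
    Run step w c c' := by
  induction w generalizing c with
  | nil => exact hinj _ _ fun k => Option.some.inj (h k)
  | cons l w ih =>
    obtain ⟨d, hd⟩ := h2 l c (fun k hk => by
      have := h k
      rw [runL_cons, hk] at this
      simp at this)
    refine ⟨d, hd, ih fun k => ?_⟩
    have := h k
    rwa [runL_cons, h1 _ _ _ hd k] at this

theorem bridge {Λ Q Tok Cfg : Type} [Fintype Λ] [Fintype Q]
    (act : Λ → Q → Option Q) (hact : Function.Injective act) (posOf : Cfg → Tok → Q)
    (step : Λ → Cfg → Cfg → Prop)
    (h1 : ∀ l c c', step l c c' → ∀ k, act l (posOf c k) = some (posOf c' k))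
    (h2 : ∀ l c, (∀ k, act l (posOf c k) ≠ none) → ∃ c', step l c c')
    (hinj : ∀ c c', (∀ k, posOf c k = posOf c' k) → c = c')
    (c0 c1 : Cfg) (w0 : List Λ) (hw0 : w0 ≠ []) (hrun : Run step w0 c0 c1) (B : ℕ)
    (hB : ∀ w, Run step w c0 c1 → B ≤ w.length) :
    ∃ A : Finset (Fin (Fintype.card Q) → Option (Fin (Fintype.card Q))),
      A.card = Fintype.card Λ ∧
      ∃ f, (∃ w, Expresses A w f) ∧ (∀ w, Expresses A w f → B ≤ w.length) := by
  classical
  let e := Fintype.equivFin Q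
  let T : Λ → (Fin (Fintype.card Q) → Option (Fin (Fintype.card Q))) :=
    fun l q => (act l (e.symm q)).map e
  have hT : Function.Injective T := by
    intro a b hab
    apply hact
    funext q
    have := congrFun hab (e q)
    simp only [T, Equiv.symm_apply_apply] at this
    exact Option.map_injective e.injective this
  have key : ∀ (w : List Λ) q, ptApply (w.map T) q = (runL act w (e.symm q)).map e := by
    intro w
    have : ∀ o : Option (Fin (Fintype.card Q)),
        (w.map T).foldl (fun o f => o.bind f) o =
          (w.foldl (fun o l => o.bind (act l)) (o.map e.symm)).map e := by
      induction w with
      | nil => intro o; cases o <;> simp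
      | cons l w ih =>
        intro o
        simp only [List.map_cons, List.foldl_cons]
        rw [ih]
        congr 2
        cases o with
        | none => rfl
        | some q =>
          simp only [Option.bind_some, Option.map_some, T]
          cases act l (e.symm q) <;> simp
    intro q
    exact this (some q)
  refine ⟨Finset.univ.image T, ?_, fun q => ptApply (w0.map T) q, ⟨w0.map T, ?_, ?_, rfl⟩, ?_⟩
  · rw [Finset.card_image_of_injective _ hT, Finset.card_univ]
  · simpa using hw0
  · intro g hg
    obtain ⟨l, _, rfl⟩ := List.mem_map.1 hg
    simp
  · rintro w ⟨hne, hA, hf⟩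
    obtain ⟨v, rfl⟩ : ∃ v : List Λ, w = v.map T := by
      clear hf hne
      induction w with
      | nil => exact ⟨[], rfl⟩
      | cons a w ih =>
        obtain ⟨v, rfl⟩ := ih (fun g hg => hA g (List.mem_cons_of_mem _ hg))
        obtain ⟨l, _, rfl⟩ := Finset.mem_image.1 (hA a (by simp))
        exact ⟨l :: v, rfl⟩
    rw [List.length_map]
    apply hB
    apply runL_run act posOf step h1 h2 hinj
    intro k
    have := congrFun hf (e (posOf c0 k))
    simp only [key, Equiv.symm_apply_apply] at this
    rw [Option.map_injective e.injective this]
    exact run_runL act posOf step h1 hrun k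

/-! ### Part 2: a binary counter -/

/-- Operations on the binary counter. -/
inductive GOp | r | c0 | c1 | tau | rho | idl

/-- States of the counter: rotating bits, head marker, carry flag. -/
abbrev GQ (ℓ : ℕ) := (Fin (ℓ + 1) × Bool) ⊕ Fin (ℓ + 1) ⊕ Bool

/-- Tokens of the counter. -/
abbrev GT (ℓ : ℕ) := Fin (ℓ + 1) ⊕ Unit ⊕ Unit

/-- Action of the operations on the bit states. -/
def bitAct {ℓ : ℕ} (ini : Fin (ℓ + 1) → Bool) : GOp → Fin (ℓ + 1) × Bool →
    Option (Fin (ℓ + 1) × Bool)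
  | .r, (p, b) => some (p - 1, b)
  | .c0, (p, b) => if p = 0 then (if b then none else some (p - 1, true)) else some (p - 1, b)
  | .c1, (p, b) => if p = 0 then (if b then some (p - 1, false) else none) else some (p - 1, b)
  | .tau, q => some q
  | .rho, (p, b) => if b = decide (p = 0) then some (p - 1, ini (p - 1)) else none
  | .idl, q => some q

/-- Action of the operations on the head marker. -/
def markAct {ℓ : ℕ} : GOp → Fin (ℓ + 1) → Option (Fin (ℓ + 1))
  | .r, h => some (h + 1)
  | .c0, h => some (h + 1)
  | .c1, h => if h = Fin.last ℓ then none else some (h + 1)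
  | .tau, h => if h = 0 then some h else none
  | .rho, h => if h = Fin.last ℓ then some 0 else none
  | .idl, h => some h

/-- Action of the operations on the carry flag. -/
def carAct : GOp → Bool → Option Bool
  | .r, c => if c then none else some false
  | .c0, c => if c then some false else none
  | .c1, c => if c then some true else none
  | .tau, c => if c then none else some true
  | .rho, c => if c then some false else none
  | .idl, c => some c

/-- Action on counter states. -/
def gAct {ℓ : ℕ} (ini : Fin (ℓ + 1) → Bool) (op : GOp) : GQ ℓ → Option (GQ ℓ)
  | .inl q => (bitAct ini op q).map Sum.inl
  | .inr (.inl h) => (markAct op h).map (Sum.inr ∘ Sum.inl)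
  | .inr (.inr c) => (carAct op c).map (Sum.inr ∘ Sum.inr)

/-- Logical state of the counter. -/
@[ext]
structure GS (ℓ : ℕ) where
  b : Fin (ℓ + 1) → Bool
  h : Fin (ℓ + 1)
  c : Bool

/-- Token positions for a logical state. -/
def gPos {ℓ : ℕ} (g : GS ℓ) : GT ℓ → GQ ℓ
  | .inl j => .inl (j - g.h, g.b j)
  | .inr (.inl _) => .inr (.inl g.h)
  | .inr (.inr _) => .inr (.inr g.c)

/-- Step relation of the counter. -/
def gStep {ℓ : ℕ} (ini : Fin (ℓ + 1) → Bool) (op : GOp) (g g' : GS ℓ) : Prop :=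
  ∀ k, gAct ini op (gPos g k) = some (gPos g' k)

lemma gPos_inj {ℓ : ℕ} {g g' : GS ℓ} (h : ∀ k, gPos g k = gPos g' k) : g = g' := by
  have h2 := h (.inr (.inl ()))
  have h3 := h (.inr (.inr ()))
  simp only [gPos, Sum.inr.injEq, Sum.inl.injEq] at h2 h3
  ext j
  · have h1 := h (.inl j)
    simp only [gPos, Sum.inl.injEq, Prod.mk.injEq] at h1
    rw [h1.2]
  · rw [h2]
  · rw [h3]

/-- Value represented by the counter, with pending carry. -/
def bval {ℓ : ℕ} (b : Fin (ℓ + 1) → Bool) : ℕ := ∑ j, if b j then 2 ^ (j : ℕ) else 0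

/-- Value represented by the counter, with pending carry. -/
def gval {ℓ : ℕ} (g : GS ℓ) : ℕ := bval g.b + if g.c then 2 ^ (g.h : ℕ) else 0

lemma bval_lt {ℓ : ℕ} (b : Fin (ℓ + 1) → Bool) : bval b < 2 ^ (ℓ + 1) := by
  have h1 : bval b ≤ ∑ j : Fin (ℓ + 1), 2 ^ (j : ℕ) := by
    apply Finset.sum_le_sum
    intro j _
    split <;> simp
  have h2 : ∑ j : Fin (ℓ + 1), 2 ^ (j : ℕ) + 1 = 2 ^ (ℓ + 1) := by
    rw [Fin.sum_univ_eq_sum_range (fun i => 2 ^ i) (ℓ + 1), Nat.geomSum_eq (le_refl 2)]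
    have := Nat.one_le_two_pow (n := ℓ + 1)
    simp; omega
  omega

lemma bval_update {ℓ : ℕ} (b : Fin (ℓ + 1) → Bool) (h : Fin (ℓ + 1)) (x : Bool) :
    bval (Function.update b h x) + (if b h then 2 ^ (h : ℕ) else 0)
      = bval b + (if x then 2 ^ (h : ℕ) else 0) := by
  unfold bval
  rw [← Finset.add_sum_erase _ _ (Finset.mem_univ h),
    ← Finset.add_sum_erase (a := h) _ (fun j => if b j then 2 ^ (j : ℕ) else 0)
      (Finset.mem_univ h)]
  have : ∑ j ∈ Finset.univ.erase h, (if Function.update b h x j then 2 ^ (j : ℕ) else 0)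
      = ∑ j ∈ Finset.univ.erase h, (if b j then 2 ^ (j : ℕ) else 0) := by
    apply Finset.sum_congr rfl
    intro j hj
    rw [Function.update_of_ne (Finset.ne_of_mem_erase hj)]
  rw [this]
  simp only [Function.update_self]
  omega

lemma sum_testBit (n v : ℕ) (hv : v < 2 ^ n) :
    ∑ j : Fin n, (if v.testBit j then 2 ^ (j : ℕ) else 0) = v := by
  induction n generalizing v with
  | zero => simp at hv; simp [hv]
  | succ n ih =>
    rw [Fin.sum_univ_succ]
    have h := ih (v / 2) (by rw [pow_succ] at hv; omega)
    have h2 : ∑ j : Fin n, (if v.testBit (j.succ : Fin (n + 1)) then 2 ^ ((j.succ : Fin (n + 1)) : ℕ)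
        else 0) = 2 * ∑ j : Fin n, (if (v / 2).testBit j then 2 ^ (j : ℕ) else 0) := by
      rw [Finset.mul_sum]
      apply Finset.sum_congr rfl
      intro j _
      rw [Fin.val_succ, Nat.testBit_succ, pow_succ]
      split <;> ring
    rw [h2, h]
    simp only [Fin.val_zero, Nat.testBit_zero, pow_zero, decide_eq_true_eq]
    split <;> omega

lemma exists_bval {ℓ : ℕ} (v : ℕ) (hv : v < 2 ^ (ℓ + 1)) :
    ∃ b : Fin (ℓ + 1) → Bool, bval b = v :=
  ⟨fun j => v.testBit j, sum_testBit _ _ hv⟩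

/-- When an operation is possible. -/
def gLive {ℓ : ℕ} : GOp → GS ℓ → Prop
  | .r, g => g.c = false
  | .c0, g => g.c = true ∧ g.b g.h = false
  | .c1, g => g.c = true ∧ g.b g.h = true ∧ g.h ≠ Fin.last ℓ
  | .tau, g => g.c = false ∧ g.h = 0
  | .rho, g => g.c = true ∧ g.h = Fin.last ℓ ∧ ∀ j, g.b j = decide (j = g.h)
  | .idl, _ => True

/-- Result of an operation. -/
def gNext {ℓ : ℕ} (ini : Fin (ℓ + 1) → Bool) : GOp → GS ℓ → GS ℓ
  | .r, g => ⟨g.b, g.h + 1, g.c⟩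
  | .c0, g => ⟨Function.update g.b g.h true, g.h + 1, false⟩
  | .c1, g => ⟨Function.update g.b g.h false, g.h + 1, true⟩
  | .tau, g => ⟨g.b, g.h, true⟩
  | .rho, _ => ⟨ini, 0, false⟩
  | .idl, g => g

lemma last_add_one (ℓ : ℕ) : Fin.last ℓ + 1 = 0 := by simp

lemma gStep_next {ℓ : ℕ} (ini : Fin (ℓ + 1) → Bool) (op : GOp) (g : GS ℓ) (hg : gLive op g) :
    gStep ini op g (gNext ini op g) := by
  obtain ⟨b, h, c⟩ := g
  rintro (j | _ | _)
  · have hlast : j - Fin.last ℓ - 1 = j := by rw [sub_sub, last_add_one, sub_zero]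
    by_cases hj : j = h
    · subst hj
      cases op with
      | rho =>
        obtain ⟨h1, h2, h3⟩ := hg
        simp only at h1 h2 h3
        subst h2
        have h4 : (0 : Fin (ℓ + 1)) - 1 = Fin.last ℓ := by
          rw [sub_eq_iff_eq_add, last_add_one]
        simp [gNext, gAct, gPos, bitAct, h3, h4]
      | _ => simp_all [gLive, gNext, gAct, gPos, bitAct]
    · have hj' : j - h ≠ 0 := sub_ne_zero.2 hj
      cases op with
      | rho =>
        obtain ⟨h1, h2, h3⟩ := hg
        simp only at h1 h2 h3
        subst h2
        simp [gNext, gAct, gPos, bitAct, h3, hlast, hj, hj']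
      | _ => simp_all [gLive, gNext, gAct, gPos, bitAct, sub_add_eq_sub_sub]
  · cases op <;> simp_all [gLive, gNext, gAct, gPos, markAct]
  · cases op <;> simp_all [gLive, gNext, gAct, gPos, carAct]

lemma gLive_of {ℓ : ℕ} (ini : Fin (ℓ + 1) → Bool) (op : GOp) (g : GS ℓ)
    (hg : ∀ k, gAct ini op (gPos g k) ≠ none) : gLive op g := by
  obtain ⟨b, h, c⟩ := g
  have h1 := fun j => hg (.inl j)
  have h2 := hg (.inr (.inl ()))
  have h3 := hg (.inr (.inr ()))
  have h0 := h1 h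
  cases op <;> simp_all [gLive, gAct, gPos, bitAct, markAct, carAct, sub_eq_zero]


lemma gStep_iff {ℓ : ℕ} (ini : Fin (ℓ + 1) → Bool) (op : GOp) (g g' : GS ℓ) :
    gStep ini op g g' ↔ gLive op g ∧ g' = gNext ini op g := by
  constructor
  · intro h
    have hl : gLive op g := gLive_of ini op g fun k => by rw [h k]; simp
    refine ⟨hl, gPos_inj fun k => ?_⟩
    have := gStep_next ini op g hl k
    rw [h k] at this
    exact Option.some.inj this
  · rintro ⟨h, rfl⟩
    exact gStep_next ini op g h

/-- Internal operations of the counter. -/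
inductive Micro | r | c0 | c1
  deriving DecidableEq

instance : Fintype Micro := ⟨{.r, .c0, .c1}, by intro x; cases x <;> simp⟩

/-- Internal operations as operations. -/
def Micro.op : Micro → GOp
  | .r => .r
  | .c0 => .c0
  | .c1 => .c1

lemma val_add_one {ℓ : ℕ} {h : Fin (ℓ + 1)} (hh : h ≠ Fin.last ℓ) :
    ((h + 1 : Fin (ℓ + 1)) : ℕ) = h + 1 :=
  Fin.val_add_one_of_lt (Fin.lt_last_iff_ne_last.2 hh)

lemma gval_micro {ℓ : ℕ} {ini : Fin (ℓ + 1) → Bool} {m : Micro} {g g' : GS ℓ}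
    (h : gStep ini m.op g g') : gval g' = gval g := by
  obtain ⟨h1, rfl⟩ := (gStep_iff _ _ _ _).1 h
  clear h
  obtain ⟨b, h, c⟩ := g
  cases m
  · simp only [gLive, Micro.op] at h1
    simp [gval, gNext, Micro.op, h1]
  · simp only [gLive, Micro.op] at h1
    have := bval_update b h true
    simp_all [gval, gNext, Micro.op]
  · simp only [gLive, Micro.op] at h1
    have := bval_update b h false
    simp_all [gval, gNext, Micro.op, val_add_one h1.2.2]
    rw [pow_succ]; omega

lemma gval_tau {ℓ : ℕ} {ini : Fin (ℓ + 1) → Bool} {g g' : GS ℓ}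
    (h : gStep ini .tau g g') : gval g' = gval g + 1 ∧ gval g < 2 ^ (ℓ + 1) := by
  obtain ⟨h1, rfl⟩ := (gStep_iff _ _ _ _).1 h
  clear h
  obtain ⟨b, h, c⟩ := g
  simp only [gLive] at h1
  have := bval_lt b
  simp_all [gval, gNext]

lemma gval_rho {ℓ : ℕ} {g : GS ℓ} (h1 : gLive .rho g) : gval g = 2 ^ (ℓ + 1) := by
  obtain ⟨b, h, c⟩ := g
  obtain ⟨h1, h2, h3⟩ := h1
  simp only at h1 h2 h3
  subst h1 h2
  have : bval b = 2 ^ ℓ := by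
    unfold bval
    simp [h3]
  simp only [gval, this, if_true, Fin.val_last, pow_succ]
  omega

/-- The counter is ready for the next tick, or for the reset. -/
def gReady {ℓ : ℕ} (g : GS ℓ) : Prop := (g.c = false ∧ g.h = 0) ∨ gLive .rho g

lemma gReady_tau {ℓ : ℕ} {g : GS ℓ} (h : gReady g) (hv : gval g < 2 ^ (ℓ + 1)) :
    gLive .tau g := by
  rcases h with h | h
  · exact h
  · have := gval_rho h
    omega

lemma gReady_rho {ℓ : ℕ} {g : GS ℓ} (h : gReady g) (hv : gval g = 2 ^ (ℓ + 1)) :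
    gLive .rho g := by
  rcases h with h | h
  · have := bval_lt g.b
    simp [gval, h.1] at hv
    omega
  · exact h

lemma rotate_ready {ℓ : ℕ} (ini : Fin (ℓ + 1) → Bool) (n : ℕ) (g : GS ℓ) (hc : g.c = false)
    (hn : ℓ + 1 - (g.h : ℕ) = n) :
    ∃ w g', Run (fun m : Micro => gStep ini m.op) w g g' ∧ gReady g' := by
  induction n generalizing g with
  | zero => have := g.h.2; omega
  | succ n ih =>
    have hst : gStep ini Micro.r.op g (gNext ini .r g) := gStep_next ini .r g hc
    by_cases hl : g.h = Fin.last ℓ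
    · exact ⟨[.r], _, ⟨_, hst, rfl⟩, Or.inl ⟨hc, by simp [gNext, hl]⟩⟩
    · obtain ⟨w, g', h1, h2⟩ := ih (gNext ini .r g) hc (by
        simp only [gNext, val_add_one hl]; omega)
      exact ⟨.r :: w, g', ⟨_, hst, h1⟩, h2⟩

lemma carry_ready {ℓ : ℕ} (ini : Fin (ℓ + 1) → Bool) (n : ℕ) (g : GS ℓ) (hc : g.c = true)
    (hlow : ∀ j < g.h, g.b j = false) (hn : ℓ + 1 - (g.h : ℕ) = n) :
    ∃ w g', Run (fun m : Micro => gStep ini m.op) w g g' ∧ gReady g' := by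
  induction n generalizing g with
  | zero => have := g.h.2; omega
  | succ n ih =>
    cases hb : g.b g.h with
    | false =>
      have hst : gStep ini Micro.c0.op g (gNext ini .c0 g) := gStep_next ini .c0 g ⟨hc, hb⟩
      obtain ⟨w, g', h1, h2⟩ := rotate_ready ini _ (gNext ini .c0 g) rfl rfl
      exact ⟨.c0 :: w, g', ⟨_, hst, h1⟩, h2⟩
    | true =>
      by_cases hl : g.h = Fin.last ℓ
      · refine ⟨[], g, rfl, Or.inr ⟨hc, hl, fun j => ?_⟩⟩
        by_cases hj : j = g.h
        · simp [hj, hb]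
        · rw [hlow j (by rw [hl] at hj ⊢; exact Fin.lt_last_iff_ne_last.2 hj)]
          simp [hj]
      · have hst : gStep ini Micro.c1.op g (gNext ini .c1 g) :=
          gStep_next ini .c1 g ⟨hc, hb, hl⟩
        obtain ⟨w, g', h1, h2⟩ := ih (gNext ini .c1 g) rfl (by
            intro j hj
            simp only [gNext] at hj ⊢
            by_cases hjh : j = g.h
            · simp [hjh]
            · rw [Function.update_of_ne hjh]
              apply hlow
              rw [Fin.lt_def, val_add_one hl] at hj
              rw [Fin.lt_def]
              have : (j : ℕ) ≠ g.h := fun h => hjh (Fin.ext h)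
              omega) (by simp only [gNext, val_add_one hl]; omega)
        exact ⟨.c1 :: w, g', ⟨_, hst, h1⟩, h2⟩

lemma gval_run {ℓ : ℕ} {ini : Fin (ℓ + 1) → Bool} {w : List Micro} {g g' : GS ℓ}
    (h : Run (fun m : Micro => gStep ini m.op) w g g') : gval g' = gval g := by
  induction w generalizing g with
  | nil => cases h; rfl
  | cons m w ih =>
    obtain ⟨d, hd, h⟩ := h
    rw [ih h, gval_micro hd]

lemma tick_ready {ℓ : ℕ} (ini : Fin (ℓ + 1) → Bool) (g : GS ℓ) (hg : gReady g)
    (hv : gval g < 2 ^ (ℓ + 1)) :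
    ∃ d w g', gStep ini .tau g d ∧ Run (fun m : Micro => gStep ini m.op) w d g' ∧
      gReady g' ∧ gval g' = gval g + 1 := by
  have hl := gReady_tau hg hv
  have hst := gStep_next ini .tau g hl
  obtain ⟨w, g', h1, h2⟩ := carry_ready ini _ (gNext ini .tau g) rfl (by
    intro j hj
    simp only [gNext, hl.2] at hj
    exact absurd hj (by simp)) rfl
  exact ⟨_, w, g', hst, h1, h2, by rw [gval_run h1, (gval_tau hst).1]⟩

/-! ### Part 3: cool-lex order of combinations -/

/-- Control states of the scanner. -/
inductive Ctl | st | a1 | a0 | a2 | pl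
  deriving DecidableEq

instance : Fintype Ctl := ⟨{.st, .a1, .a0, .a2, .pl}, by intro x; cases x <;> simp⟩

/-- Transition of the control. -/
def nxt : Ctl → Bool → Ctl
  | .st, true => .a1
  | .st, false => .a0
  | .a1, true => .a1
  | .a1, false => .a0
  | .a0, true => .a2
  | .a0, false => .a0
  | .a2, _ => .pl
  | .pl, _ => .pl

/-- One scanning step. -/
def sc {T : Type*} (q : Ctl × Option T × List (Option T)) (e : Bool × Option T) :
    Ctl × Option T × List (Option T) :=
  if q.1 = .pl then (.pl, q.2.1, q.2.2 ++ [e.2]) else (nxt q.1 e.1, e.2, q.2.2 ++ [q.2.1])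

/-- Scan a word. -/
def scan {T : Type*} (D : List (Bool × Option T)) : Ctl × Option T × List (Option T) :=
  D.foldl sc (.st, none, [])

/-- Tag with true claims. -/
def tag {T : Type*} (x : Option T) : Bool × Option T := (x.isSome, x)

/-- A full pass. -/
def pass {T : Type*} (l : List (Option T)) : List (Option T) :=
  (scan (l.map tag)).2.1 :: (scan (l.map tag)).2.2.tail

section scanning
variable {T : Type*}

lemma foldA (A : List (Option T)) (hA : ∀ x ∈ A, x.isSome = true) (c : Ctl) (h : Option T)
    (out : List (Option T)) (hc : c = .st ∨ c = .a1) :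
    ∃ c' h' out', (A.map tag).foldl sc (c, h, out) = (c', h', out') ∧
      out' ++ [h'] = out ++ [h] ++ A ∧ (c' = .st ∨ c' = .a1) := by
  induction A generalizing c h out with
  | nil => exact ⟨c, h, out, rfl, by simp, hc⟩
  | cons x A ih =>
    have hx : x.isSome = true := hA x (by simp)
    obtain ⟨c', h', out', h1, h2, h3⟩ := ih (fun y hy => hA y (by simp [hy])) .a1 x (out ++ [h])
      (Or.inr rfl)
    refine ⟨c', h', out', ?_, by simp [h2], h3⟩
    rw [List.map_cons, List.foldl_cons, ← h1]
    congr 1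
    rcases hc with rfl | rfl <;> simp [sc, tag, hx, nxt]

lemma foldZ (Z : List (Option T)) (hZ : ∀ x ∈ Z, x.isSome = false) (c : Ctl) (h : Option T)
    (out : List (Option T)) (hc : c = .st ∨ c = .a1 ∨ c = .a0) :
    ∃ c' h' out', (Z.map tag).foldl sc (c, h, out) = (c', h', out') ∧
      out' ++ [h'] = out ++ [h] ++ Z ∧ (c' = .st ∨ c' = .a1 ∨ c' = .a0) ∧
      (Z ≠ [] → c' = .a0) := by
  induction Z generalizing c h out with
  | nil => exact ⟨c, h, out, rfl, by simp, hc, by simp⟩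
  | cons x A ih =>
    have hx : x.isSome = false := hZ x (by simp)
    obtain ⟨c', h', out', h1, h2, h3, h4⟩ := ih (fun y hy => hZ y (by simp [hy])) .a0 x
      (out ++ [h]) (by simp)
    refine ⟨c', h', out', ?_, by simp [h2], h3, fun _ => ?_⟩
    · rw [List.map_cons, List.foldl_cons, ← h1]
      congr 1
      rcases hc with rfl | rfl | rfl <;> simp [sc, tag, hx, nxt]
    · by_cases hA : A = []
      · subst hA
        simp only [List.map_nil, List.foldl_nil, Prod.mk.injEq] at h1
        exact h1.1.symm
      · exact h4 hA

lemma foldV (V : List (Bool × Option T)) (h : Option T) (out : List (Option T)) :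
    V.foldl sc (.pl, h, out) = (.pl, h, out ++ V.map Prod.snd) := by
  induction V generalizing out with
  | nil => simp
  | cons x V ih => simp [sc, ih]

lemma scan_AZ (A Z : List (Option T)) (hA : ∀ x ∈ A, x.isSome = true)
    (hZ : ∀ x ∈ Z, x.isSome = false) :
    (scan ((A ++ Z).map tag)).1 ≠ .a2 ∧ (scan ((A ++ Z).map tag)).1 ≠ .pl := by
  obtain ⟨c1, h1, o1, e1, -, g1⟩ := foldA A hA .st none [] (by simp)
  obtain ⟨c2, h2, o2, e2, -, g2, -⟩ := foldZ Z hZ c1 h1 o1 (by tauto)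
  have : (scan ((A ++ Z).map tag)).1 = c2 := by
    rw [scan, List.map_append, List.foldl_append, e1, e2]
  rw [this]
  rcases g2 with rfl | rfl | rfl <;> simp

lemma scan_AZx (A Z : List (Option T)) (x : Option T) (hA : ∀ x ∈ A, x.isSome = true)
    (hZ : ∀ x ∈ Z, x.isSome = false) (hZ' : Z ≠ []) (hx : x.isSome = true) :
    scan ((A ++ Z ++ [x]).map tag) = (.a2, x, none :: (A ++ Z)) := by
  obtain ⟨c1, h1, o1, e1, f1, g1⟩ := foldA A hA .st none [] (by simp)
  obtain ⟨c2, h2, o2, e2, f2, g2, k2⟩ := foldZ Z hZ c1 h1 o1 (by tauto)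
  rw [scan, List.map_append, List.map_append, List.foldl_append, List.foldl_append, e1, e2,
    k2 hZ']
  simp [sc, tag, nxt, hx, f2, f1]

lemma scan_full (A Z : List (Option T)) (x c : Option T) (v : List (Option T))
    (hA : ∀ x ∈ A, x.isSome = true)
    (hZ : ∀ x ∈ Z, x.isSome = false) (hZ' : Z ≠ []) (hx : x.isSome = true) :
    scan ((A ++ Z ++ x :: c :: v).map tag) = (.pl, c, none :: (A ++ Z ++ [x] ++ v)) := by
  have e : A ++ Z ++ x :: c :: v = (A ++ Z ++ [x]) ++ (c :: v) := by simp
  have h := scan_AZx A Z x hA hZ hZ' hx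
  unfold scan at h ⊢
  rw [e, List.map_append, List.foldl_append, h, List.map_cons, List.foldl_cons]
  simp only [sc, nxt, reduceCtorEq, if_false, tag]
  rw [foldV]
  simp [List.map_map, Function.comp_def, tag]

lemma pass_end (A Z : List (Option T)) (x : Option T) (hA : ∀ x ∈ A, x.isSome = true)
    (hZ : ∀ x ∈ Z, x.isSome = false) (hZ' : Z ≠ []) (hx : x.isSome = true) :
    pass (A ++ Z ++ [x]) = x :: (A ++ Z) := by
  rw [pass, scan_AZx A Z x hA hZ hZ' hx]; rfl

lemma pass_full (A Z : List (Option T)) (x c : Option T) (v : List (Option T))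
    (hA : ∀ x ∈ A, x.isSome = true)
    (hZ : ∀ x ∈ Z, x.isSome = false) (hZ' : Z ≠ []) (hx : x.isSome = true) :
    pass (A ++ Z ++ x :: c :: v) = c :: (A ++ Z ++ [x] ++ v) := by
  rw [pass, scan_full A Z x c v hA hZ hZ' hx]; rfl

lemma parse (l : List (Option T)) :
    (∃ A Z, l = A ++ Z ∧ (∀ x ∈ A, x.isSome = true) ∧ (∀ x ∈ Z, x.isSome = false)) ∨
    (∃ A Z x v, l = A ++ Z ++ x :: v ∧ (∀ x ∈ A, x.isSome = true) ∧
      (∀ x ∈ Z, x.isSome = false) ∧ Z ≠ [] ∧ x.isSome = true) := by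
  induction l with
  | nil => exact Or.inl ⟨[], [], by simp⟩
  | cons y l ih =>
    cases hy : y.isSome with
    | true =>
      rcases ih with ⟨A, Z, h1, h2, h3⟩ | ⟨A, Z, x, v, h1, h2, h3, h4, h5⟩
      · exact Or.inl ⟨y :: A, Z, by simp [h1], by simpa [hy] using h2, h3⟩
      · exact Or.inr ⟨y :: A, Z, x, v, by simp [h1], by simpa [hy] using h2, h3, h4, h5⟩
    | false =>
      rcases ih with ⟨A, Z, h1, h2, h3⟩ | ⟨A, Z, x, v, h1, h2, h3, h4, h5⟩
      · cases A with
        | nil => exact Or.inl ⟨[], y :: Z, by simp [h1], by simp, (by intro z hz; rcases List.mem_cons.1 hz with rfl | hz; exacts [hy, h3 z hz])⟩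
        | cons a A =>
          exact Or.inr ⟨[], [y], a, A ++ Z, by simp [h1], by simp, by simpa using hy, by simp,
            h2 a (by simp)⟩
      · cases A with
        | nil => exact Or.inr ⟨[], y :: Z, x, v, by simp [h1], by simp, 
            (by intro z hz; rcases List.mem_cons.1 hz with rfl | hz; exacts [hy, h3 z hz]),
            by simp, h5⟩
        | cons a A =>
          exact Or.inr ⟨[], [y], a, A ++ Z ++ x :: v, by simp [h1], by simp,
            by simpa using hy, by simp, h2 a (by simp)⟩

lemma scan_map {U : Type*} (f : T → U) (l : List (Option T)) (c : Ctl) (h : Option T)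
    (out : List (Option T)) :
    ((l.map (Option.map f)).map tag).foldl sc (c, h.map f, out.map (Option.map f)) =
      (((l.map tag).foldl sc (c, h, out)).1, ((l.map tag).foldl sc (c, h, out)).2.1.map f,
        ((l.map tag).foldl sc (c, h, out)).2.2.map (Option.map f)) := by
  induction l generalizing c h out with
  | nil => rfl
  | cons x l ih =>
    simp only [List.map_cons, List.foldl_cons]
    by_cases hc : c = .pl
    · have := ih .pl h (out ++ [x])
      simpa [sc, hc, tag] using this
    · have := ih (nxt c x.isSome) x (out ++ [h])
      simpa [sc, hc, tag] using this

lemma pass_map {U : Type*} (f : T → U) (l : List (Option T)) :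
    pass (l.map (Option.map f)) = (pass l).map (Option.map f) := by
  have := scan_map f l .st none []
  simp only [Option.map_none, List.map_nil] at this
  unfold pass scan
  rw [this]
  simp

end scanning

/-- Rank contribution of the tail. -/
def rk : ℕ → ℕ → List Bool → ℕ
  | _, _, [] => 0
  | p, m, false :: ys => rk (p + 1) m ys
  | p, m, true :: ys => (p.choose (m + 1) - 1) + rk (p + 1) (m + 1) ys

/-- Rank after `a` ones and `b` zeros. -/
def r0 (a : ℕ) : ℕ → List Bool → ℕ
  | b, [] => (a + b).choose a - 1
  | b, false :: ys => r0 a (b + 1) ys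
  | b, true :: ys => ((a + b + 1).choose (a + 1) - 2) + rk (a + b + 1) (a + 1) ys

/-- Rank after `a` ones. -/
def r1 : ℕ → List Bool → ℕ
  | _, [] => 0
  | a, true :: ys => r1 (a + 1) ys
  | a, false :: ys => r0 a 1 ys

lemma r1_rep (a j : ℕ) (ys : List Bool) :
    r1 a (List.replicate j true ++ ys) = r1 (a + j) ys := by
  induction j generalizing a with
  | zero => rfl
  | succ j ih =>
    rw [List.replicate_succ, List.cons_append, r1, ih]; congr 1; omega

lemma r0_rep (a b j : ℕ) (ys : List Bool) :
    r0 a b (List.replicate j false ++ ys) = r0 a (b + j) ys := by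
  induction j generalizing b with
  | zero => rfl
  | succ j ih =>
    rw [List.replicate_succ, List.cons_append, r0, ih]; congr 1; omega

lemma rk_rep_false (p m j : ℕ) (ys : List Bool) :
    rk p m (List.replicate j false ++ ys) = rk (p + j) m ys := by
  induction j generalizing p with
  | zero => rfl
  | succ j ih =>
    rw [List.replicate_succ, List.cons_append, rk, ih]; congr 1; omega

lemma rk_rep_true (m j : ℕ) (ys : List Bool) :
    rk (m + 1) m (List.replicate j true ++ ys) = rk (m + j + 1) (m + j) ys := by
  induction j generalizing m with
  | zero => rfl
  | succ j ih =>
    rw [List.replicate_succ, List.cons_append, rk, ih]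
    simp only [Nat.choose_self, Nat.sub_self, zero_add]
    congr 1 <;> omega

lemma r1_AZ (a b : ℕ) :
    r1 0 (List.replicate a true ++ List.replicate b false) = (a + b).choose a - 1 := by
  rw [r1_rep]
  cases b with
  | zero => simp [r1]
  | succ b =>
    rw [List.replicate_succ, r1]
    have := r0_rep (0 + a) 1 b []
    rw [List.append_nil] at this
    rw [this, r0]
    congr 2 <;> omega

lemma r1_AZx (a b : ℕ) (ys : List Bool) :
    r1 0 (List.replicate a true ++ List.replicate (b + 1) false ++ true :: ys) =
      ((a + b + 2).choose (a + 1) - 2) + rk (a + b + 2) (a + 1) ys := by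
  rw [List.append_assoc, r1_rep, List.replicate_succ, List.cons_append, r1, r0_rep, r0]
  have e1 : 0 + a = a := by omega
  have e2 : a + (1 + b) + 1 = a + b + 2 := by omega
  rw [e1, e2]

lemma rk_bound (p m : ℕ) (ys : List Bool) :
    rk p m ys + p.choose m ≤ (p + ys.length).choose (m + ys.count true) := by
  induction ys generalizing p m with
  | nil => simp [rk]
  | cons y ys ih =>
    cases y with
    | false =>
      have h := ih (p + 1) m
      have h2 : p.choose m ≤ (p + 1).choose m := Nat.choose_le_choose _ (by omega)
      have e : p + 1 + ys.length = p + (ys.length + 1) := by omega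
      simp only [rk, List.length_cons, List.count_cons] 
      rw [e] at h
      simp
      omega
    | true =>
      have h := ih (p + 1) (m + 1)
      have h2 := Nat.choose_succ_succ' p m
      have e : p + 1 + ys.length = p + (ys.length + 1) := by omega
      have e' : m + 1 + ys.count true = m + (ys.count true + 1) := by omega
      rw [e, e'] at h
      simp only [rk, List.length_cons, List.count_cons_self]
      omega

lemma r0_bound (a b : ℕ) (ys : List Bool) :
    r0 a b ys + 1 ≤ (a + b + ys.length).choose (a + ys.count true) := by
  induction ys generalizing b with
  | nil =>
    have : 0 < (a + b).choose a := Nat.choose_pos (by omega)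
    simp [r0]; omega
  | cons y ys ih =>
    cases y with
    | false =>
      have h := ih (b + 1)
      have e : a + (b + 1) + ys.length = a + b + (ys.length + 1) := by omega
      rw [e] at h
      simpa [r0] using h
    | true =>
      have h := rk_bound (a + b + 1) (a + 1) ys
      have e : a + b + 1 + ys.length = a + b + (ys.length + 1) := by omega
      have e' : a + 1 + ys.count true = a + (ys.count true + 1) := by omega
      have : 0 < (a + b + 1).choose (a + 1) := Nat.choose_pos (by omega)
      rw [e, e'] at h
      simp only [r0, List.length_cons, List.count_cons_self]
      omega

lemma r1_bound (a : ℕ) (ys : List Bool) :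
    r1 a ys + 1 ≤ (a + ys.length).choose (a + ys.count true) := by
  induction ys generalizing a with
  | nil => simp [r1]
  | cons y ys ih =>
    cases y with
    | false =>
      have h := r0_bound a 1 ys
      have e : a + 1 + ys.length = a + (ys.length + 1) := by omega
      rw [e] at h
      simpa [r1] using h
    | true =>
      have h := ih (a + 1)
      have e : a + 1 + ys.length = a + (ys.length + 1) := by omega
      have e' : a + 1 + ys.count true = a + (ys.count true + 1) := by omega
      rw [e, e'] at h
      simpa [r1] using h

lemma rank_end (a b : ℕ) :
    r1 0 (true :: (List.replicate a true ++ List.replicate (b + 1) false)) =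
      r1 0 (List.replicate a true ++ List.replicate (b + 1) false ++ [true]) + 1 := by
  rw [r1_AZx, ← List.cons_append, ← List.replicate_succ, r1_AZ, rk]
  have h : (a + b + 2).choose (a + 1) = (a + b + 1).choose a + (a + b + 1).choose (a + 1) :=
    Nat.choose_succ_succ' _ _
  have h1 : 0 < (a + b + 1).choose a := Nat.choose_pos (by omega)
  have h2 : 0 < (a + b + 1).choose (a + 1) := Nat.choose_pos (by omega)
  have e : a + 1 + (b + 1) = a + b + 2 := by omega
  rw [e]
  omega

lemma rank_true (a b : ℕ) (v : List Bool) :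
    r1 0 (true :: (List.replicate a true ++ List.replicate (b + 1) false ++ [true] ++ v)) =
      r1 0 (List.replicate a true ++ List.replicate (b + 1) false ++ true :: true :: v) + 1 := by
  have e0 : true :: (List.replicate a true ++ List.replicate (b + 1) false ++ [true] ++ v) =
    List.replicate (a + 1) true ++ List.replicate (b + 1) false ++ true :: v := by
    simp [List.replicate_succ]
  rw [e0, r1_AZx, r1_AZx, rk]
  have h : (a + b + 2).choose (a + 1) = (a + b + 1).choose a + (a + b + 1).choose (a + 1) :=
    Nat.choose_succ_succ' _ _
  have h' : (a + b + 2 + 1).choose (a + 1 + 1) =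
      (a + b + 2).choose (a + 1) + (a + b + 2).choose (a + 1 + 1) :=
    Nat.choose_succ_succ' _ _
  have h1 : 0 < (a + b + 1).choose a := Nat.choose_pos (by omega)
  have h2 : 0 < (a + b + 1).choose (a + 1) := Nat.choose_pos (by omega)
  have h3 : 0 < (a + b + 2).choose (a + 1 + 1) := Nat.choose_pos (by omega)
  have e : a + 1 + b + 2 = a + b + 2 + 1 := by omega
  rw [e]
  omega

lemma rank_false (a b : ℕ) (v : List Bool) :
    r1 0 (false :: (List.replicate a true ++ List.replicate (b + 1) false ++ [true] ++ v)) =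
      r1 0 (List.replicate a true ++ List.replicate (b + 1) false ++ true :: false :: v) + 1 := by
  rw [r1_AZx, rk]
  have h : (a + b + 2).choose (a + 1) = (a + b + 1).choose a + (a + b + 1).choose (a + 1) :=
    Nat.choose_succ_succ' _ _
  have h1 : 0 < (a + b + 1).choose a := Nat.choose_pos (by omega)
  have h2 : 0 < (a + b + 1).choose (a + 1) := Nat.choose_pos (by omega)
  cases a with
  | zero =>
    have e0 : false :: (List.replicate 0 true ++ List.replicate (b + 1) false ++ [true] ++ v) =
      List.replicate 0 true ++ List.replicate (b + 1 + 1) false ++ true :: v := by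
      simp [List.replicate_succ]
    rw [e0, r1_AZx]
    simp only [zero_add, Nat.choose_one_right]
    have e : b + 1 + 2 = b + 2 + 1 := by omega
    rw [e]
    omega
  | succ a =>
    have e0 : false :: (List.replicate (a + 1) true ++ List.replicate (b + 1) false ++ [true] ++ v)
      = List.replicate 0 true ++ List.replicate (0 + 1) false ++ true ::
        (List.replicate a true ++ (List.replicate (b + 1) false ++ true :: v)) := by
      simp [List.replicate_succ]
    rw [e0, r1_AZx, rk_rep_true, rk_rep_false, rk]
    have e1 : 0 + 1 + a + 1 + (b + 1) = a + 1 + b + 2 := by omega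
    have e2 : 0 + 1 + a = a + 1 := by omega
    have e3 : (0 + 0 + 2).choose (0 + 1) = 2 := by decide
    rw [e1, e2, e3]
    omega

/-! ### The sequence of lists -/

section lists
variable {t s : ℕ}

/-- The starting list. -/
def alpha (t s : ℕ) : List (Option (Fin t)) :=
  none :: ((List.finRange t).map some ++ List.replicate s none)

/-- The final list of a cool-lex round. -/
def top (s : ℕ) (u : Fin t → Fin t) : List (Option (Fin t)) :=
  (List.finRange t).map (fun j => some (u j)) ++ List.replicate (s + 1) none

/-- Rearrangements. -/
def Valid (s : ℕ) (l : List (Option (Fin t))) : Prop := l.Perm (alpha t s)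

/-- Rank of a list. -/
def rank (l : List (Option (Fin t))) : ℕ := r1 0 (l.map Option.isSome)

/-- First all tokens, then all blanks. -/
def IsTop (l : List (Option (Fin t))) : Prop :=
  ∃ A Z, l = A ++ Z ∧ (∀ x ∈ A, x.isSome = true) ∧ (∀ x ∈ Z, x.isSome = false)

/-- Number of shapes. -/
def Cc (t s : ℕ) : ℕ := (t + s + 1).choose t

lemma Cc_pos : 0 < Cc t s := Nat.choose_pos (by omega)

lemma Valid.length {l : List (Option (Fin t))} (h : Valid s l) : l.length = t + s + 1 := by
  rw [List.Perm.length_eq h]; simp [alpha]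

lemma Valid.shape {l : List (Option (Fin t))} (h : Valid s l) :
    (l.map Option.isSome).count true = t := by
  rw [(List.Perm.map Option.isSome h).count_eq]
  simp [alpha, Function.comp_def, List.count_replicate]

lemma Valid.red {l : List (Option (Fin t))} (h : Valid s l) :
    (l.filterMap id).Perm (List.finRange t) := by
  refine (List.Perm.filterMap id h).trans ?_
  simp [alpha, List.filterMap_append, List.filterMap_map, List.filterMap_replicate_of_none]

lemma Valid.mem {l : List (Option (Fin t))} (h : Valid s l) (u : Fin t) : some u ∈ l := by
  rw [List.Perm.mem_iff h]; simp [alpha]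

lemma Valid.nodup {l : List (Option (Fin t))} (h : Valid s l) : (l.filterMap id).Nodup :=
  (List.Perm.nodup_iff h.red).2 (List.nodup_finRange t)

lemma Valid.rank_lt {l : List (Option (Fin t))} (h : Valid s l) : rank l + 1 ≤ Cc t s := by
  have := r1_bound 0 (l.map Option.isSome)
  rw [h.shape, List.length_map, h.length, zero_add, zero_add] at this
  exact this

lemma map_true {T : Type*} (A : List (Option T)) (hA : ∀ x ∈ A, x.isSome = true) :
    A.map Option.isSome = List.replicate A.length true := by
  rw [List.map_eq_replicate_iff]; exact hA

lemma map_false {T : Type*} (A : List (Option T)) (hA : ∀ x ∈ A, x.isSome = false) :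
    A.map Option.isSome = List.replicate A.length false := by
  rw [List.map_eq_replicate_iff]; exact hA

lemma Valid.rank_top {l : List (Option (Fin t))} (h : Valid s l) (ht : IsTop l) :
    rank l = Cc t s - 1 := by
  obtain ⟨A, Z, rfl, hA, hZ⟩ := ht
  have h1 := h.shape
  have h2 := h.length
  rw [List.map_append, map_true A hA, map_false Z hZ] at h1
  simp [List.count_replicate] at h1
  simp at h2
  rw [rank, List.map_append, map_true A hA, map_false Z hZ, r1_AZ, h2, h1, Cc]

lemma Valid.pass {l : List (Option (Fin t))} (h : Valid s l) (ht : ¬ IsTop l) :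
    Valid s (pass l) ∧ rank (pass l) = rank l + 1 ∧
      ((scan (l.map tag)).1 = .a2 ∨ (scan (l.map tag)).1 = .pl) := by
  rcases parse l with h0 | ⟨A, Z, x, v, rfl, hA, hZ, hZ', hx⟩
  · exact absurd h0 ht
  obtain ⟨b, hb⟩ : ∃ b, Z.length = b + 1 := by
    cases Z with
    | nil => exact absurd rfl hZ'
    | cons z Z => exact ⟨Z.length, rfl⟩
  cases v with
  | nil =>
    rw [pass_end A Z x hA hZ hZ' hx, scan_AZx A Z x hA hZ hZ' hx]
    refine ⟨?_, ?_, Or.inl rfl⟩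
    · refine List.Perm.trans ?_ h
      exact (List.perm_append_singleton x (A ++ Z)).symm
    · simp only [rank, List.map_append, List.map_cons, map_true A hA, map_false Z hZ, hb, hx,
        List.map_nil]
      exact rank_end _ _
  | cons c v =>
    rw [pass_full A Z x c v hA hZ hZ' hx, scan_full A Z x c v hA hZ hZ' hx]
    refine ⟨?_, ?_, Or.inr rfl⟩
    · refine List.Perm.trans ?_ h
      have e : A ++ Z ++ x :: c :: v = (A ++ Z ++ [x]) ++ (c :: v) := by simp
      rw [e]
      exact List.perm_middle.symm
    · simp only [rank, List.map_append, List.map_cons, map_true A hA, map_false Z hZ, hb, hx,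
        List.map_nil]
      cases c.isSome
      · exact rank_false _ _ _
      · exact rank_true _ _ _

lemma Valid.isTop_iff {l : List (Option (Fin t))} (h : Valid s l) :
    IsTop l ↔ rank l = Cc t s - 1 := by
  refine ⟨h.rank_top, fun hr => ?_⟩
  by_contra hn
  obtain ⟨h1, h2, -⟩ := h.pass hn
  have := h1.rank_lt
  have := Cc_pos (t := t) (s := s)
  omega

lemma not_top_of_ctl {l : List (Option (Fin t))}
    (hc : (scan (l.map tag)).1 = .a2 ∨ (scan (l.map tag)).1 = .pl) : ¬ IsTop l := by
  rintro ⟨A, Z, rfl, hA, hZ⟩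
  have := scan_AZ A Z hA hZ
  tauto

lemma Valid.eq_top {l : List (Option (Fin t))} (h : Valid s l) (ht : IsTop l) :
    ∃ τ : Equiv.Perm (Fin t), l = top s τ := by
  have hr := h.red
  have hl := h.length
  have hs := h.shape
  obtain ⟨A, Z, rfl, hA, hZ⟩ := ht
  rw [List.map_append, map_true A hA, map_false Z hZ] at hs
  simp [List.count_replicate] at hs
  simp at hl
  have hZ0 : Z = List.replicate (s + 1) none := by
    rw [List.eq_replicate_iff]
    exact ⟨by omega, fun b hb => by simpa using hZ b hb⟩
  obtain ⟨B, rfl⟩ : ∃ B : List (Fin t), A = B.map some := by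
    refine ⟨A.filterMap id, ?_⟩
    clear hr hl hs h
    induction A with
    | nil => rfl
    | cons a A ih =>
      obtain ⟨b, rfl⟩ := Option.isSome_iff_exists.1 (hA a (by simp))
      have := ih (fun x hx => hA x (by simp [hx]))
      exact congrArg (List.cons (some b)) this
  subst hZ0
  have hB : B.Perm (List.finRange t) := by
    simpa [List.filterMap_append, List.filterMap_map, List.filterMap_replicate_of_none] using hr
  have hlen : B.length = t := by simpa using hB.length_eq
  have hnd : B.Nodup := hB.nodup_iff.2 (List.nodup_finRange t)
  let f : Fin t → Fin t := fun j => B[(j : ℕ)]'(by rw [hlen]; exact j.2)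
  have hf : Function.Injective f := by
    intro i j hij
    have := (List.Nodup.getElem_inj_iff hnd).1 hij
    exact Fin.ext this
  refine ⟨Equiv.ofBijective f (Finite.injective_iff_bijective.1 hf), ?_⟩
  unfold top
  congr 1
  apply List.ext_getElem
  · simp [hlen]
  · intro i h1 h2
    simp [f]

lemma Valid.map {l : List (Option (Fin t))} (h : Valid s l) (σ : Equiv.Perm (Fin t)) :
    Valid s (l.map (Option.map σ)) := by
  refine (List.Perm.map (Option.map σ) h).trans ?_
  simp only [alpha, List.map_cons, List.map_append, List.map_map, Option.map_none,
    List.map_replicate]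
  refine List.Perm.cons _ (List.Perm.append_right _ ?_)
  have := (List.Perm.map some (Equiv.Perm.map_finRange_perm σ))
  rw [List.map_map] at this
  exact this

lemma shape_map (l : List (Option (Fin t))) (σ : Fin t → Fin t) :
    rank (l.map (Option.map σ)) = rank l := by
  unfold rank
  rw [List.map_map]
  congr 2
  funext x
  cases x <;> rfl

lemma valid_alpha : Valid s (alpha t s) := List.Perm.refl _

lemma rank_alpha : rank (alpha t s) = 0 := by
  have : (alpha t s).map Option.isSome =
      false :: (List.replicate t true ++ List.replicate s false) := by
    simp only [alpha, List.map_cons, List.map_append, List.map_map, List.map_replicate]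
    simp [Function.comp_def]
  rw [rank, this, r1]
  cases t with
  | zero =>
    have := r0_rep 0 1 s []
    simp at this
    simp [this, r0]
  | succ t =>
    rw [List.replicate_succ, List.cons_append, r0]
    have h1 := rk_rep_true 1 t (List.replicate s false)
    have h2 := rk_rep_false (1 + t + 1) (1 + t) s []
    rw [List.append_nil] at h2
    have e : rk (0 + 1 + 1) (0 + 1) (List.replicate t true ++ List.replicate s false) = 0 := by
      exact h1.trans h2
    rw [e]; rfl

lemma pass_iter (i : ℕ) (hi : i < Cc t s) :
    Valid s (pass^[i] (alpha t s)) ∧ rank (pass^[i] (alpha t s)) = i := by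
  induction i with
  | zero => exact ⟨valid_alpha, rank_alpha⟩
  | succ i ih =>
    obtain ⟨h1, h2⟩ := ih (by omega)
    rw [Function.iterate_succ_apply']
    have hn : ¬ IsTop (pass^[i] (alpha t s)) := by
      rw [h1.isTop_iff]; omega
    obtain ⟨h3, h4, -⟩ := h1.pass hn
    exact ⟨h3, by omega⟩

lemma exists_tau (t s : ℕ) :
    ∃ τ : Equiv.Perm (Fin t), pass^[Cc t s - 1] (alpha t s) = top s τ := by
  have hp := Cc_pos (t := t) (s := s)
  obtain ⟨h1, h2⟩ := pass_iter (t := t) (s := s) (Cc t s - 1) (by omega)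
  exact h1.eq_top (h1.isTop_iff.2 h2)

/-- The sequence of lists visited. -/
def seq (s : ℕ) (σ : Equiv.Perm (Fin t)) (n : ℕ) : List (Option (Fin t)) :=
  (pass^[n % Cc t s] (alpha t s)).map (Option.map (σ ^ (n / Cc t s) : Equiv.Perm (Fin t)))

variable (σ : Equiv.Perm (Fin t))

lemma seq_valid (n : ℕ) : Valid s (seq s σ n) :=
  (pass_iter _ (Nat.mod_lt _ Cc_pos)).1.map _

lemma seq_rank (n : ℕ) : rank (seq s σ n) = n % Cc t s := by
  rw [seq, shape_map, (pass_iter _ (Nat.mod_lt _ Cc_pos)).2]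

lemma seq_isTop (n : ℕ) : IsTop (seq s σ n) ↔ n % Cc t s = Cc t s - 1 := by
  rw [(seq_valid σ n).isTop_iff, seq_rank]

lemma seq_pass (n : ℕ) (h : ¬ IsTop (seq s σ n)) : seq s σ (n + 1) = pass (seq s σ n) := by
  rw [seq_isTop] at h
  have hp := Cc_pos (t := t) (s := s)
  have hlt := Nat.mod_lt n hp
  have hd := Nat.div_add_mod n (Cc t s)
  have e1 : (n + 1) % Cc t s = n % Cc t s + 1 := by
    have h3 : n + 1 = Cc t s * (n / Cc t s) + (n % Cc t s + 1) := by omega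
    calc (n + 1) % Cc t s = (Cc t s * (n / Cc t s) + (n % Cc t s + 1)) % Cc t s := by rw [← h3]
      _ = n % Cc t s + 1 := by rw [Nat.mul_add_mod, Nat.mod_eq_of_lt (by omega)]
  have e2 : (n + 1) / Cc t s = n / Cc t s := by
    have h3 : n + 1 = Cc t s * (n / Cc t s) + (n % Cc t s + 1) := by omega
    calc (n + 1) / Cc t s = (Cc t s * (n / Cc t s) + (n % Cc t s + 1)) / Cc t s := by rw [← h3]
      _ = n / Cc t s := by rw [Nat.mul_add_div hp, Nat.div_eq_of_lt (a := n % Cc t s + 1) (by omega), add_zero]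
  unfold seq
  rw [pass_map, e1, e2, Function.iterate_succ_apply']

lemma seq_top (τ : Equiv.Perm (Fin t)) (hτ : pass^[Cc t s - 1] (alpha t s) = top s τ)
    (n : ℕ) (h : IsTop (seq s σ n)) :
    seq s σ n = top s (fun i => (σ ^ (n / Cc t s)) (τ i)) ∧
      seq s σ (n + 1) = none :: ((List.finRange t).map
        (fun j => some ((σ ^ (n / Cc t s)) (σ j))) ++ List.replicate s none) := by
  rw [seq_isTop] at h
  have hp := Cc_pos (t := t) (s := s)
  have hd := Nat.div_add_mod n (Cc t s)
  have e0 : n + 1 = Cc t s * (n / Cc t s + 1) := by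
    rw [Nat.mul_add]; omega
  have e1 : (n + 1) % Cc t s = 0 := by rw [e0]; simp
  have e2 : (n + 1) / Cc t s = n / Cc t s + 1 := by
    rw [e0, Nat.mul_div_cancel_left _ hp]
  constructor
  · rw [seq, h, hτ, top, top]
    simp [Function.comp_def]
  · rw [seq, e1, e2]
    simp [alpha, Function.comp_def, pow_succ]

lemma seq_final (n : ℕ) (h : seq s σ n = seq s σ (Cc t s * orderOf σ - 1)) :
    Cc t s * orderOf σ - 1 ≤ n := by
  have hp := Cc_pos (t := t) (s := s)
  have hg : 0 < orderOf σ := orderOf_pos σ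
  obtain ⟨g, hg'⟩ : ∃ g, orderOf σ = g + 1 := ⟨orderOf σ - 1, by omega⟩
  set N := Cc t s * orderOf σ - 1 with hN
  have hN' : N = Cc t s * g + (Cc t s - 1) := by
    rw [hN, hg', Nat.mul_add]; omega
  have e1 : N % Cc t s = Cc t s - 1 := by
    rw [hN', Nat.mul_add_mod, Nat.mod_eq_of_lt (by omega)]
  have e2 : N / Cc t s = g := by
    rw [hN', Nat.mul_add_div hp, Nat.div_eq_of_lt (by omega)]; omega
  have e3 : n % Cc t s = Cc t s - 1 := by
    rw [← seq_rank σ n, h, seq_rank, e1]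
  have hd := Nat.div_add_mod n (Cc t s)
  have hpow : σ ^ (n / Cc t s) = σ ^ g := by
    unfold seq at h
    rw [e1, e2, e3, List.map_inj_left] at h
    ext u
    have hv := (pass_iter (t := t) (s := s) (Cc t s - 1) (by omega)).1
    have := h (some u) (hv.mem u)
    simp at this
    exact congrArg _ this
  have hge : g ≤ n / Cc t s := by
    by_contra hlt
    have := pow_injOn_Iio_orderOf (x := σ) (x₁ := n / Cc t s) (x₂ := g)
      (by simp; omega) (by simp; omega) hpow
    omega
  have := Nat.mul_le_mul_left (Cc t s) hge
  omega

end lists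

/-! ### Part 4: the machine -/

/-- The alphabet. -/
inductive Letter
  | S (y : Bool) | P (y : Bool) | E | W | gz (m : Micro) | go (m : Micro)
  deriving DecidableEq

instance : Fintype Letter :=
  ⟨{.S true, .S false, .P true, .P false, .E, .W, .gz .r, .gz .c0, .gz .c1,
    .go .r, .go .c0, .go .c1}, by
    intro x
    cases x with
    | S y => cases y <;> simp
    | P y => cases y <;> simp
    | E => simp
    | W => simp
    | gz m => cases m <;> simp
    | go m => cases m <;> simp⟩

section machine
variable {t s ℓ : ℕ}

/-- Action on the main track. -/
def mainAct (w : Fin t → Fin t) : Letter → Fin (t + s + 2) → Option (Fin (t + s + 2))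
  | .S y, i => if i.1 = 0 then (if y then some (Fin.last _) else none)
      else some ⟨i.1 - 1, by omega⟩
  | .P y, i => if i.1 = 0 then (if y then some ⟨t + s, by omega⟩ else none)
      else if i.1 = t + s + 1 then some i else some ⟨i.1 - 1, by omega⟩
  | .E, i => if i.1 = 0 then none else if i.1 = t + s + 1 then some ⟨0, by omega⟩ else some i
  | .W, i => if h : i.1 < t then some ⟨(w ⟨i.1, h⟩).1 + 1, by omega⟩ else none
  | .gz _, i => some i
  | .go _, i => some i

/-- Action on the control. -/
def ctlAct : Letter → Ctl → Option Ctl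
  | .S y, c => if c = .pl then none else some (nxt c y)
  | .P _, c => if c = .pl then some .pl else none
  | .E, c => if c = .a2 ∨ c = .pl then some .st else none
  | .W, c => if c = .st then some .st else none
  | .gz _, c => some c
  | .go _, c => some c

/-- Operation of the blank counter. -/
def opz : Letter → GOp
  | .S false => .tau
  | .P false => .tau
  | .E => .rho
  | .gz m => m.op
  | _ => .idl

/-- Operation of the token counter. -/
def opo : Letter → GOp
  | .S true => .tau
  | .P true => .tau
  | .E => .rho
  | .go m => m.op
  | _ => .idl

/-- The list `X` describes the token positions `pm`. -/
def Rep (pm : Fin t → Fin (t + s + 2)) (X : List (Option (Fin t))) : Prop :=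
  X.length = t + s + 2 ∧ ∀ (u : Fin t) (i : Fin (t + s + 2)),
    X[(i : ℕ)]? = some (some u) ↔ pm u = i

lemma Rep.unique {pm pm' : Fin t → Fin (t + s + 2)} {X : List (Option (Fin t))}
    (h : Rep pm X) (h' : Rep pm' X) : pm = pm' := by
  funext u
  exact (((h'.2 u (pm u)).1 ((h.2 u (pm u)).2 rfl))).symm

lemma Rep.step {pm pm' : Fin t → Fin (t + s + 2)} {X X' : List (Option (Fin t))}
    (h : Rep pm X) (φ : Fin (t + s + 2) → Option (Fin (t + s + 2)))
    (hφ : ∀ u, φ (pm u) = some (pm' u)) (hlen : X'.length = t + s + 2)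
    (hf : ∀ i j : Fin (t + s + 2), φ i = some j → X'[(j : ℕ)]? = X[(i : ℕ)]?)
    (hb : ∀ (j : Fin (t + s + 2)) u, X'[(j : ℕ)]? = some (some u) → ∃ i, φ i = some j) : Rep pm' X' := by
  refine ⟨hlen, fun u j => ⟨fun hj => ?_, fun hj => ?_⟩⟩
  · obtain ⟨i, hi⟩ := hb j u hj
    have h1 := hf i j hi
    rw [hj] at h1
    have h2 := (h.2 u i).1 h1.symm
    have h3 := hφ u
    rw [h2, hi] at h3
    exact (Option.some.inj h3).symm
  · subst hj
    rw [hf _ _ (hφ u)]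
    exact (h.2 u _).2 rfl

lemma Rep.zero {pm pm' : Fin t → Fin (t + s + 2)} {x : Option (Fin t)}
    {R : List (Option (Fin t))}
    (h : Rep pm (x :: R)) (φ : Fin (t + s + 2) → Option (Fin (t + s + 2)))
    (hφ : ∀ u, φ (pm u) = some (pm' u)) (h0 : φ ⟨0, by omega⟩ = none) : x = none := by
  cases x with
  | none => rfl
  | some u =>
    have h1 := (h.2 u ⟨0, by omega⟩).1 (by simp)
    have := hφ u
    rw [h1, h0] at this
    exact absurd this (by simp)

variable {w : Fin t → Fin t}

lemma rep_S {pm pm' : Fin t → Fin (t + s + 2)} {x : Option (Fin t)} {R : List (Option (Fin t))}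
    {y : Bool} (h : Rep pm (x :: R)) (hφ : ∀ u, mainAct w (.S y) (pm u) = some (pm' u)) :
    Rep pm' (R ++ [x]) ∧ (y = false → x = none) := by
  have hx : y = false → x = none := by
    rintro rfl
    exact h.zero _ hφ (by simp [mainAct])
  have hl : R.length = t + s + 1 := by simpa using h.1
  refine ⟨h.step _ hφ (by simp [hl]) ?_ ?_, hx⟩
  · intro i j hij
    obtain ⟨i, hi⟩ := i
    cases i with
    | zero =>
      cases y with
      | false => simp [mainAct] at hij
      | true =>
        simp [mainAct] at hij
        subst hij
        simp [List.getElem?_append, hl]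
    | succ i =>
      simp [mainAct] at hij
      subst hij
      simp only [List.getElem?_cons_succ]
      rw [List.getElem?_append_left (by omega)]
  · intro j u hj
    by_cases hj' : j.1 = t + s + 1
    · cases y with
      | false =>
        rw [hx rfl] at hj
        simp [List.getElem?_append, hl, hj'] at hj
      | true =>
        exact ⟨⟨0, by omega⟩, by simp [mainAct]; exact Fin.ext (by simp [hj'])⟩
    · refine ⟨⟨j.1 + 1, by omega⟩, by simp [mainAct]⟩

lemma rep_P {pm pm' : Fin t → Fin (t + s + 2)} {x h0 : Option (Fin t)}
    {R : List (Option (Fin t))}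
    {y : Bool} (h : Rep pm (x :: R ++ [h0])) (hφ : ∀ u, mainAct w (.P y) (pm u) = some (pm' u)) :
    Rep pm' (R ++ [x] ++ [h0]) ∧ (y = false → x = none) := by
  have hx : y = false → x = none := by
    rintro rfl
    exact Rep.zero (R := R ++ [h0]) h _ hφ (by simp [mainAct])
  have hl : R.length = t + s := by simpa using h.1
  refine ⟨h.step _ hφ (by simp [hl]) ?_ ?_, hx⟩
  · intro i j hij
    obtain ⟨i, hi⟩ := i
    cases i with
    | zero =>
      cases y with
      | false => simp [mainAct] at hij
      | true =>
        simp [mainAct] at hij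
        subst hij
        simp [List.getElem?_append, hl]
    | succ i =>
      by_cases hi' : i = t + s
      · subst hi'
        simp [mainAct] at hij
        subst hij
        simp [List.getElem?_append, hl]
      · simp [mainAct, hi'] at hij
        subst hij
        have : i < R.length := by omega
        simp [List.getElem?_append, this]
  · intro j u hj
    by_cases hj' : j.1 = t + s
    · cases y with
      | false =>
        rw [hx rfl] at hj
        simp [List.getElem?_append, hl, hj'] at hj
      | true =>
        exact ⟨⟨0, by omega⟩, by simp [mainAct]; exact Fin.ext (by simp [hj'])⟩
    · by_cases hj2 : j.1 = t + s + 1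
      · exact ⟨j, by simp [mainAct, hj2]⟩
      · refine ⟨⟨j.1 + 1, by omega⟩, by simp [mainAct, hj']⟩

lemma rep_E {pm pm' : Fin t → Fin (t + s + 2)} {x h0 : Option (Fin t)}
    {R : List (Option (Fin t))}
    (h : Rep pm (x :: R ++ [h0])) (hφ : ∀ u, mainAct w .E (pm u) = some (pm' u)) :
    Rep pm' (h0 :: R ++ [none]) := by
  have hl : R.length = t + s := by simpa using h.1
  refine h.step _ hφ (by simp [hl]) ?_ ?_
  · intro i j hij
    obtain ⟨i, hi⟩ := i
    cases i with
    | zero => simp [mainAct] at hij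
    | succ i =>
      by_cases hi' : i = t + s
      · subst hi'
        simp [mainAct] at hij
        subst hij
        simp [List.getElem?_append, hl]
      · simp [mainAct, hi'] at hij
        subst hij
        have : i < R.length := by omega
        simp [List.getElem?_append, this]
  · intro j u hj
    by_cases hj0 : j.1 = 0
    · exact ⟨⟨t + s + 1, by omega⟩, by simp [mainAct]; exact Fin.ext (by simp [hj0])⟩
    · by_cases hj2 : j.1 = t + s + 1
      · simp [List.getElem?_append, hl, hj2] at hj
      · refine ⟨j, by simp [mainAct, hj0, hj2]⟩

lemma rep_W {pm pm' : Fin t → Fin (t + s + 2)} {τ σ ρ : Equiv.Perm (Fin t)}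
    (h : Rep pm (top s (fun i => ρ (τ i)) ++ [none]))
    (hφ : ∀ u, mainAct (σ⁻¹ * τ : Equiv.Perm (Fin t)) .W (pm u) = some (pm' u)) :
    Rep pm' (none :: ((List.finRange t).map (fun j => some (ρ (σ j))) ++ List.replicate s none)
      ++ [none]) := by
  refine h.step _ hφ (by simp; omega) ?_ ?_
  · intro i j hij
    by_cases hi : i.1 < t
    · simp [mainAct, hi] at hij
      subst hij
      simp [top, List.getElem?_append, hi]
    · simp [mainAct, hi] at hij
  · intro j u hj
    obtain ⟨j, hj'⟩ := j
    cases j with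
    | zero => simp at hj
    | succ j =>
      have hjt : j < t := by
        by_contra hn
        simp [List.getElem?_append, hn] at hj
        split_ifs at hj <;> simp_all [List.getElem?_replicate, List.getElem?_cons]
      refine ⟨⟨((σ⁻¹ * τ)⁻¹ : Equiv.Perm (Fin t)) ⟨j, hjt⟩, by omega⟩, ?_⟩
      simp [mainAct]

lemma rep_alpha : Rep (fun u : Fin t => (⟨u.1 + 1, by omega⟩ : Fin (t + s + 2)))
    (alpha t s ++ [none]) := by
  refine ⟨by simp [alpha]; omega, fun u i => ?_⟩
  obtain ⟨i, hi⟩ := i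
  cases i with
  | zero => simp [alpha]
  | succ i =>
    by_cases hit : i < t
    · simp [alpha, List.getElem?_append, hit, Fin.ext_iff, eq_comm]
    · have : u.1 ≠ i := by omega
      simp [alpha, List.getElem?_append, hit, this]
      split_ifs <;> simp_all [List.getElem?_replicate, List.getElem?_cons]

end machine

/-! ### Part 5: soundness -/

section sound
variable {t s ℓ : ℕ}

/-- Configurations of the machine. -/
@[ext]
structure Cfg (t s ℓ : ℕ) where
  pm : Fin t → Fin (t + s + 2)
  c : Ctl
  gz : GS ℓ
  go : GS ℓ

/-- The step relation of the machine. -/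
def mStep (w : Fin t → Fin t) (iz io : Fin (ℓ + 1) → Bool) (l : Letter) (a b : Cfg t s ℓ) : Prop :=
  (∀ u, mainAct w l (a.pm u) = some (b.pm u)) ∧ ctlAct l a.c = some b.c ∧
    gStep iz (opz l) a.gz b.gz ∧ gStep io (opo l) a.go b.go

/-- Counter values after claims `D`. -/
structure Cnt (t s ℓ : ℕ) (gz go : GS ℓ) (D : List Bool) : Prop where
  hz : gval gz + (s + 1) = 2 ^ (ℓ + 1) + D.count false
  ho : gval go + t = 2 ^ (ℓ + 1) + D.count true
  hz' : D.count false ≤ s + 1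
  ho' : D.count true ≤ t

/-- The invariant of a pass. -/
structure InvD (σ : Equiv.Perm (Fin t)) (n : ℕ) (a : Cfg t s ℓ)
    (D : List (Bool × Option (Fin t))) (rest : List (Option (Fin t))) : Prop where
  hseq : seq s σ n = D.map Prod.snd ++ rest
  hcl : ∀ p ∈ D, p.1 = false → p.2 = none
  hc : (scan D).1 = a.c
  hrep : Rep a.pm (rest ++ (scan D).2.2 ++ [(scan D).2.1])
  hcnt : Cnt t s ℓ a.gz a.go (D.map Prod.fst)

lemma gStep_idl {ini : Fin (ℓ + 1) → Bool} {g g' : GS ℓ} (h : gStep ini .idl g g') : g' = g :=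
  ((gStep_iff _ _ _ _).1 h).2

lemma gStep_rho {ini : Fin (ℓ + 1) → Bool} {g g' : GS ℓ} (h : gStep ini .rho g g') :
    gval g = 2 ^ (ℓ + 1) ∧ g' = ⟨ini, 0, false⟩ :=
  ⟨gval_rho ((gStep_iff _ _ _ _).1 h).1, ((gStep_iff _ _ _ _).1 h).2⟩

lemma cnt_start {iz io : Fin (ℓ + 1) → Bool} (hiz : bval iz + (s + 1) = 2 ^ (ℓ + 1))
    (hio : bval io + t = 2 ^ (ℓ + 1)) :
    Cnt t s ℓ (⟨iz, 0, false⟩ : GS ℓ) (⟨io, 0, false⟩ : GS ℓ) [] := by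
  constructor <;> simp [gval, hiz, hio]

lemma Cnt.tick {iz io : Fin (ℓ + 1) → Bool} {gz go gz' go' : GS ℓ} {D : List Bool} {y : Bool}
    (h : Cnt t s ℓ gz go D)
    (h1 : gStep iz (if y then .idl else .tau) gz gz')
    (h2 : gStep io (if y then .tau else .idl) go go') :
    Cnt t s ℓ gz' go' (D ++ [y]) ∧ D.length < t + s + 1 := by
  obtain ⟨a1, a2, a3, a4⟩ := h
  have hl := List.count_false_add_count_true D
  cases y with
  | false =>
    have := gStep_idl h2
    subst this
    obtain ⟨b1, b2⟩ := gval_tau h1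
    refine ⟨⟨?_, ?_, ?_, ?_⟩, ?_⟩ <;> simp <;> omega
  | true =>
    have := gStep_idl h1
    subst this
    obtain ⟨b1, b2⟩ := gval_tau h2
    refine ⟨⟨?_, ?_, ?_, ?_⟩, ?_⟩ <;> simp <;> omega

lemma scan_snoc {T : Type*} (D : List (Bool × Option T)) (e : Bool × Option T) :
    scan (D ++ [e]) = sc (scan D) e := by
  simp [scan, List.foldl_append]

lemma scan_st {T : Type*} (D : List (Bool × Option T)) (h : (scan D).1 = .st) : D = [] := by
  induction D using List.reverseRecOn with
  | nil => rfl
  | append_singleton D e _ =>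
    rw [scan_snoc, sc] at h
    split_ifs at h
    revert h
    cases (scan D).1 <;> cases e.1 <;> simp [nxt]

lemma claims {T : Type*} (D : List (Bool × Option T)) (h : ∀ p ∈ D, p.1 = false → p.2 = none) :
    ((D.map Prod.snd).map Option.isSome).count true ≤ (D.map Prod.fst).count true ∧
    ((D.map Prod.fst).count true = ((D.map Prod.snd).map Option.isSome).count true →
      D = (D.map Prod.snd).map tag) := by
  induction D with
  | nil => simp
  | cons p D ih =>
    obtain ⟨h1, h2⟩ := ih (fun q hq => h q (by simp [hq]))
    have h3 := h p (by simp)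
    obtain ⟨y, x⟩ := p
    cases y with
    | false =>
      have : x = none := h3 rfl
      subst this
      simp only [List.map_cons, Option.isSome_none, List.count_cons, tag]
      simp only [beq_iff_eq, Bool.false_eq_true, if_false, add_zero]
      exact ⟨h1, fun hh => by rw [← h2 hh]⟩
    | true =>
      cases x with
      | none =>
        simp only [List.map_cons, Option.isSome_none, List.count_cons]
        simp only [beq_iff_eq, Bool.false_eq_true, if_false, add_zero, beq_self_eq_true, if_true]
        exact ⟨by omega, fun hh => by omega⟩
      | some u =>
        simp only [List.map_cons, Option.isSome_some, List.count_cons, tag]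
        simp only [beq_self_eq_true, if_true]
        exact ⟨by omega, fun hh => by rw [← h2 (by omega)]⟩

lemma rep_isTop {l : List (Option (Fin t))} (hv : Valid s l) {pm : Fin t → Fin (t + s + 2)}
    (h : Rep pm (l ++ [none])) (hp : ∀ u, (pm u).1 < t) : IsTop l := by
  have hlen := hv.length
  have hZ : ∀ x ∈ l.drop t, x.isSome = false := by
    intro x hx
    cases x with
    | none => rfl
    | some u =>
      exfalso
      obtain ⟨i, hi, he⟩ := List.mem_iff_getElem.1 hx
      simp at hi
      rw [List.getElem_drop] at he
      have h1 := (h.2 u ⟨t + i, by omega⟩).1 (by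
        rw [List.getElem?_append_left (by simp; omega)]
        simp [List.getElem?_eq_getElem (show t + i < l.length by omega), he])
      have := hp u
      rw [h1] at this
      simp at this
  refine ⟨l.take t, l.drop t, by simp, ?_, hZ⟩
  have hs := hv.shape
  rw [← List.take_append_drop t l, List.map_append, List.count_append, map_false _ hZ] at hs
  simp only [List.count_replicate] at hs
  have h2 : ((l.take t).map Option.isSome).count true = ((l.take t).map Option.isSome).length := by
    simp at hs ⊢
    omega
  rw [List.count_eq_length] at h2
  intro x hx
  exact (h2 x.isSome (List.mem_map_of_mem hx)).symm

variable {σ τ : Equiv.Perm (Fin t)} {iz io : Fin (ℓ + 1) → Bool}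

lemma inv_adv {n : ℕ} {a b : Cfg t s ℓ} {D : List (Bool × Option (Fin t))}
    {rest : List (Option (Fin t))} (h : InvD σ n a D rest) {l : Letter} {y : Bool}
    (hl : l = .S y ∨ l = .P y)
    (hs : mStep (σ⁻¹ * τ : Equiv.Perm (Fin t)) iz io l a b) :
    ∃ x rest', rest = x :: rest' ∧ InvD σ n b (D ++ [(y, x)]) rest' := by
  obtain ⟨s1, s2, s3, s4⟩ := hs
  have h3 : gStep iz (if y then .idl else .tau) a.gz b.gz := by
    rcases hl with rfl | rfl <;> cases y <;> exact s3
  have h4 : gStep io (if y then .tau else .idl) a.go b.go := by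
    rcases hl with rfl | rfl <;> cases y <;> exact s4
  obtain ⟨k1, k2⟩ := h.hcnt.tick h3 h4
  have hlen := (seq_valid (s := s) σ n).length
  rw [h.hseq] at hlen
  simp at hlen k2
  cases rest with
  | nil => simp at hlen; omega
  | cons x rest =>
    refine ⟨x, rest, rfl, ?_⟩
    have hrep := h.hrep
    have hc := h.hc
    have key : (y = false → x = none) ∧ (scan (D ++ [(y, x)])).1 = b.c ∧
        Rep b.pm (rest ++ (scan (D ++ [(y, x)])).2.2 ++ [(scan (D ++ [(y, x)])).2.1]) := by
      rw [scan_snoc, sc, hc]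
      rcases hl with rfl | rfl
      · simp only [ctlAct] at s2
        split_ifs at s2 with h0
        obtain ⟨r1, r2⟩ := rep_S (R := rest ++ (scan D).2.2 ++ [(scan D).2.1]) hrep s1
        rw [if_neg h0]
        refine ⟨r2, Option.some.inj s2, ?_⟩
        simpa using r1
      · simp only [ctlAct] at s2
        split_ifs at s2 with h0
        obtain ⟨r1, r2⟩ := rep_P (R := rest ++ (scan D).2.2) hrep s1
        rw [if_pos h0]
        refine ⟨r2, Option.some.inj s2, ?_⟩
        simpa using r1
    obtain ⟨q1, q2, q3⟩ := key
    refine ⟨?_, ?_, q2, q3, by simpa using k1⟩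
    · rw [h.hseq]; simp
    · intro p hp
      rcases List.mem_append.1 hp with hp | hp
      · exact h.hcl p hp
      · rw [List.mem_singleton] at hp
        subst hp
        exact q1

lemma scan_out {T : Type*} (D : List (Bool × Option T)) :
    (scan D).2.2.length = D.length ∧ ((scan D).1 ≠ .st → (scan D).2.2.head? = some none) := by
  induction D using List.reverseRecOn with
  | nil => simp [scan]
  | append_singleton D e ih =>
    obtain ⟨ih1, ih2⟩ := ih
    rw [scan_snoc, sc]
    by_cases hD : (scan D).1 = .st
    · have := scan_st D hD
      subst this
      simp [scan]
    · have h2 := ih2 hD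
      have h3 : (scan D).2.2 ≠ [] := by
        intro h0; rw [h0] at h2; simp at h2
      split_ifs with h1
      · simp [ih1, h2]
      · simp [ih1, h2]

lemma inv_E (hiz : bval iz + (s + 1) = 2 ^ (ℓ + 1))
    (hio : bval io + t = 2 ^ (ℓ + 1)) {n : ℕ} {a b : Cfg t s ℓ}
    {D : List (Bool × Option (Fin t))}
    {rest : List (Option (Fin t))} (h : InvD σ n a D rest)
    (hs : mStep (σ⁻¹ * τ : Equiv.Perm (Fin t)) iz io .E a b) :
    InvD σ (n + 1) b [] (seq s σ (n + 1)) ∧ b.c = .st ∧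
      b.gz = ⟨iz, 0, false⟩ ∧ b.go = ⟨io, 0, false⟩ := by
  obtain ⟨s1, s2, s3, s4⟩ := hs
  obtain ⟨z1, z2⟩ := gStep_rho s3
  obtain ⟨o1, o2⟩ := gStep_rho s4
  have hcz := h.hcnt.hz
  have hco := h.hcnt.ho
  have hl := List.count_false_add_count_true (D.map Prod.fst)
  have hv := seq_valid (s := s) σ n
  have hlen := hv.length
  have hsh := hv.shape
  have hseq := h.hseq
  rw [hseq] at hlen
  simp only [List.length_append, List.length_map] at hlen hl
  have hr : rest = [] := List.eq_nil_of_length_eq_zero (by omega)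
  subst hr
  rw [List.append_nil] at hseq
  have hD : D = (seq s σ n).map tag := by
    have := (claims D h.hcl).2 (by rw [← hseq, hsh]; omega)
    rw [hseq]; exact this
  have hc : (scan D).1 = .a2 ∨ (scan D).1 = .pl := by
    rw [h.hc]
    simp only [ctlAct] at s2
    split_ifs at s2 with h0
    exact h0
  have hbc : b.c = .st := by
    simp only [ctlAct] at s2
    split_ifs at s2 with h0
    exact (Option.some.inj s2).symm
  have hnt : ¬ IsTop (seq s σ n) := not_top_of_ctl (by rw [← hD]; exact hc)
  have hnext := seq_pass σ n hnt
  rw [pass, ← hD] at hnext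
  obtain ⟨oo, ho⟩ : ∃ oo, (scan D).2.2 = none :: oo := by
    have := (scan_out D).2 (by rcases hc with hc | hc <;> rw [hc] <;> simp)
    cases hh : (scan D).2.2 with
    | nil => rw [hh] at this; simp at this
    | cons x oo => rw [hh] at this; simp at this; exact ⟨oo, by rw [this]⟩
  have hrep := h.hrep
  rw [ho] at hrep hnext
  have hrep' := rep_E (R := oo) hrep s1
  refine ⟨⟨by simp, by simp, ?_, ?_, ?_⟩, hbc, z2, o2⟩
  · rw [hbc]; rfl
  · rw [hnext]; simpa [scan] using hrep'
  · rw [z2, o2]; exact cnt_start hiz hio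

lemma inv_W (hτ : pass^[Cc t s - 1] (alpha t s) = top s τ) {n : ℕ} {a b : Cfg t s ℓ}
    {D : List (Bool × Option (Fin t))}
    {rest : List (Option (Fin t))} (h : InvD σ n a D rest)
    (hs : mStep (σ⁻¹ * τ : Equiv.Perm (Fin t)) iz io .W a b) :
    InvD σ (n + 1) b [] (seq s σ (n + 1)) ∧ b.c = .st ∧ b.gz = a.gz ∧ b.go = a.go := by
  obtain ⟨s1, s2, s3, s4⟩ := hs
  have hz := gStep_idl s3
  have ho := gStep_idl s4
  simp only [ctlAct] at s2
  split_ifs at s2 with h0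
  have hbc : b.c = .st := (Option.some.inj s2).symm
  have hD : D = [] := scan_st D (by rw [h.hc, h0])
  subst hD
  have hseq := h.hseq
  simp only [List.map_nil, List.nil_append] at hseq
  subst hseq
  have hrep : Rep a.pm (seq s σ n ++ [none]) := by simpa [scan] using h.hrep
  have htop : IsTop (seq s σ n) := by
    refine rep_isTop (seq_valid σ n) hrep fun u => ?_
    by_contra hn
    have := s1 u
    simp [mainAct, hn] at this
  obtain ⟨e1, e2⟩ := seq_top σ τ hτ n htop
  rw [e1] at hrep
  have hrep' := rep_W hrep s1
  refine ⟨⟨by simp, by simp, ?_, ?_, ?_⟩, hbc, hz, ho⟩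
  · rw [hbc]; rfl
  · rw [e2]; simpa [scan] using hrep'
  · rw [hz, ho]; exact h.hcnt

lemma inv_micro {n : ℕ} {a b : Cfg t s ℓ} {D : List (Bool × Option (Fin t))}
    {rest : List (Option (Fin t))} (h : InvD σ n a D rest) {l : Letter}
    (hl : (∃ m, l = .gz m) ∨ ∃ m, l = .go m)
    (hs : mStep (σ⁻¹ * τ : Equiv.Perm (Fin t)) iz io l a b) :
    InvD σ n b D rest := by
  obtain ⟨s1, s2, s3, s4⟩ := hs
  obtain ⟨a1, a2, a3, a4, ⟨a5, a6, a7, a8⟩⟩ := h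
  have hpm : b.pm = a.pm := by
    funext u
    have := s1 u
    rcases hl with ⟨m, rfl⟩ | ⟨m, rfl⟩ <;> exact (Option.some.inj this).symm
  have hc : b.c = a.c := by
    rcases hl with ⟨m, rfl⟩ | ⟨m, rfl⟩ <;> exact (Option.some.inj s2).symm
  have hz : gval b.gz = gval a.gz := by
    rcases hl with ⟨m, rfl⟩ | ⟨m, rfl⟩
    · exact gval_micro s3
    · rw [gStep_idl s3]
  have ho : gval b.go = gval a.go := by
    rcases hl with ⟨m, rfl⟩ | ⟨m, rfl⟩
    · rw [gStep_idl s4]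
    · exact gval_micro s4
  exact ⟨a1, a2, by rw [hc, a3], by rw [hpm]; exact a4, ⟨by rw [hz, a5], by rw [ho, a6], a7, a8⟩⟩

lemma inv_run (hτ : pass^[Cc t s - 1] (alpha t s) = top s τ)
    (hiz : bval iz + (s + 1) = 2 ^ (ℓ + 1)) (hio : bval io + t = 2 ^ (ℓ + 1))
    (v : List Letter) {n : ℕ} {a b : Cfg t s ℓ} {D : List (Bool × Option (Fin t))}
    {rest : List (Option (Fin t))} (h : InvD σ n a D rest)
    (hs : Run (mStep (σ⁻¹ * τ : Equiv.Perm (Fin t)) iz io) v a b) :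
    ∃ m D' rest', InvD σ m b D' rest' ∧ m ≤ n + v.length := by
  induction v generalizing n a D rest with
  | nil => cases hs; exact ⟨n, D, rest, h, by simp⟩
  | cons l v ih =>
    obtain ⟨d, hd, hs⟩ := hs
    have key : ∃ m D' rest', InvD σ m d D' rest' ∧ m ≤ n + 1 := by
      cases l with
      | S y =>
        obtain ⟨x, r', -, h'⟩ := inv_adv h (Or.inl rfl) hd
        exact ⟨_, _, _, h', by omega⟩
      | P y =>
        obtain ⟨x, r', -, h'⟩ := inv_adv h (Or.inr rfl) hd
        exact ⟨_, _, _, h', by omega⟩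
      | E => exact ⟨_, _, _, (inv_E hiz hio h hd).1, le_rfl⟩
      | W => exact ⟨_, _, _, (inv_W hτ h hd).1, le_rfl⟩
      | gz m => exact ⟨_, _, _, inv_micro h (Or.inl ⟨m, rfl⟩) hd, by omega⟩
      | go m => exact ⟨_, _, _, inv_micro h (Or.inr ⟨m, rfl⟩) hd, by omega⟩
    obtain ⟨m, D', r', h', hm⟩ := key
    obtain ⟨m2, D2, r2, h2, hm2⟩ := ih h' hs
    exact ⟨m2, D2, r2, h2, by simp; omega⟩

end sound

/-! ### Part 6: completeness -/

section complete
variable {t s ℓ : ℕ} {σ τ : Equiv.Perm (Fin t)} {iz io : Fin (ℓ + 1) → Bool}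

lemma gStep_idl_self (ini : Fin (ℓ + 1) → Bool) (g : GS ℓ) : gStep ini .idl g g :=
  (gStep_iff _ _ _ _).2 ⟨trivial, rfl⟩

lemma run_gz {n : ℕ} {D : List (Bool × Option (Fin t))} {rest : List (Option (Fin t))}
    (v : List Micro) {d g : GS ℓ} (hr : Run (fun m : Micro => gStep iz m.op) v d g)
    (pm : Fin t → Fin (t + s + 2)) (c : Ctl) (go : GS ℓ) (h : InvD σ n ⟨pm, c, d, go⟩ D rest) :
    Run (mStep (σ⁻¹ * τ : Equiv.Perm (Fin t)) iz io) (v.map .gz) ⟨pm, c, d, go⟩ ⟨pm, c, g, go⟩ ∧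
      InvD σ n ⟨pm, c, g, go⟩ D rest := by
  induction v generalizing d with
  | nil => cases hr; exact ⟨rfl, h⟩
  | cons m v ih =>
    obtain ⟨e, he, hr⟩ := hr
    have hs : mStep (σ⁻¹ * τ : Equiv.Perm (Fin t)) iz io (.gz m) (⟨pm, c, d, go⟩ : Cfg t s ℓ)
      ⟨pm, c, e, go⟩ := ⟨fun _ => rfl, rfl, he, gStep_idl_self _ _⟩
    obtain ⟨h1, h2⟩ := ih hr (inv_micro h (Or.inl ⟨m, rfl⟩) hs)
    exact ⟨⟨_, hs, h1⟩, h2⟩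

lemma run_go {n : ℕ} {D : List (Bool × Option (Fin t))} {rest : List (Option (Fin t))}
    (v : List Micro) {d g : GS ℓ} (hr : Run (fun m : Micro => gStep io m.op) v d g)
    (pm : Fin t → Fin (t + s + 2)) (c : Ctl) (gz : GS ℓ) (h : InvD σ n ⟨pm, c, gz, d⟩ D rest) :
    Run (mStep (σ⁻¹ * τ : Equiv.Perm (Fin t)) iz io) (v.map .go) ⟨pm, c, gz, d⟩ ⟨pm, c, gz, g⟩ ∧
      InvD σ n ⟨pm, c, gz, g⟩ D rest := by
  induction v generalizing d with
  | nil => cases hr; exact ⟨rfl, h⟩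
  | cons m v ih =>
    obtain ⟨e, he, hr⟩ := hr
    have hs : mStep (σ⁻¹ * τ : Equiv.Perm (Fin t)) iz io (.go m) (⟨pm, c, gz, d⟩ : Cfg t s ℓ)
      ⟨pm, c, gz, e⟩ := ⟨fun _ => rfl, rfl, gStep_idl_self _ _, he⟩
    obtain ⟨h1, h2⟩ := ih hr (inv_micro h (Or.inr ⟨m, rfl⟩) hs)
    exact ⟨⟨_, hs, h1⟩, h2⟩

lemma map_fst_tag {T : Type*} (l : List (Option T)) :
    (l.map tag).map Prod.fst = l.map Option.isSome := by
  simp [tag, Function.comp_def]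

lemma map_snd_tag {T : Type*} (l : List (Option T)) :
    (l.map tag).map Prod.snd = l := by
  simp [tag, Function.comp_def]

lemma Valid.shape' {l : List (Option (Fin t))} (h : Valid s l) :
    (l.map Option.isSome).count false = s + 1 := by
  have h1 := h.shape
  have h2 := h.length
  have h3 := List.count_false_add_count_true (l.map Option.isSome)
  rw [List.length_map] at h3
  omega

lemma stage_adv {n : ℕ} {a : Cfg t s ℓ} {dn rest : List (Option (Fin t))} {x : Option (Fin t)}
    (h : InvD σ n a (dn.map tag) (x :: rest)) (hz : gReady a.gz) (ho : gReady a.go) :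
    ∃ v b, Run (mStep (σ⁻¹ * τ : Equiv.Perm (Fin t)) iz io) v a b ∧
      InvD σ n b ((dn ++ [x]).map tag) rest ∧ gReady b.gz ∧ gReady b.go := by
  have hv := seq_valid (s := s) σ n
  have hs1 := hv.shape
  have hs2 := hv.shape'
  have hseq := h.hseq
  rw [map_snd_tag] at hseq
  rw [hseq] at hs1 hs2
  have hcz := h.hcnt.hz
  have hco := h.hcnt.ho
  rw [map_fst_tag] at hcz hco
  -- the letter
  obtain ⟨l, c', hl, hc'⟩ : ∃ l c', (l = .S x.isSome ∨ l = .P x.isSome) ∧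
      ctlAct l a.c = some c' := by
    by_cases hc : a.c = .pl
    · exact ⟨.P x.isSome, .pl, Or.inr rfl, by simp [ctlAct, hc]⟩
    · exact ⟨.S x.isSome, nxt a.c x.isSome, Or.inl rfl, by simp [ctlAct, hc]⟩
  have hmain : ∀ u, ∃ p, mainAct (s := s) (σ⁻¹ * τ : Equiv.Perm (Fin t)) l (a.pm u) = some p := by
    intro u
    have h0 : (a.pm u).1 = 0 → x = some u := by
      intro h0
      have := (h.hrep.2 u (a.pm u)).2 rfl
      rw [h0] at this
      simpa using this
    rcases hl with rfl | rfl
    · simp only [mainAct]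
      split_ifs with h1 h2
      · exact ⟨_, rfl⟩
      · rw [h0 h1] at h2; simp at h2
      · exact ⟨_, rfl⟩
    · simp only [mainAct]
      split_ifs with h1 h2
      · exact ⟨_, rfl⟩
      · rw [h0 h1] at h2; simp at h2
      · exact ⟨_, rfl⟩
      · exact ⟨_, rfl⟩
  choose pm' hpm' using hmain
  have fin : ∀ (b : Cfg t s ℓ) rest', InvD σ n b ((dn.map tag) ++ [(x.isSome, x)]) rest' →
      InvD σ n b ((dn ++ [x]).map tag) rest' := by
    intro b rest' hh
    simpa [tag] using hh
  cases hx : x.isSome with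
  | false =>
    have hlt : gval a.gz < 2 ^ (ℓ + 1) := by
      simp [hx] at hs2
      omega
    obtain ⟨d, v, g', t1, t2, t3, t4⟩ := tick_ready iz a.gz hz hlt
    have hstep : mStep (σ⁻¹ * τ : Equiv.Perm (Fin t)) iz io l a ⟨pm', c', d, a.go⟩ := by
      refine ⟨hpm', hc', ?_, ?_⟩
      · rw [hx] at hl; rcases hl with rfl | rfl <;> exact t1
      · rw [hx] at hl; rcases hl with rfl | rfl <;> exact gStep_idl_self _ _
    obtain ⟨x', r', e1, h'⟩ := inv_adv h hl hstep
    obtain ⟨rfl, rfl⟩ := List.cons.inj e1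
    obtain ⟨q1, q2⟩ := run_gz (τ := τ) (io := io) v t2 _ _ _ h'
    exact ⟨l :: v.map .gz, _, ⟨_, hstep, q1⟩, fin _ _ q2, t3, ho⟩
  | true =>
    have hlt : gval a.go < 2 ^ (ℓ + 1) := by
      simp [hx] at hs1
      omega
    obtain ⟨d, v, g', t1, t2, t3, t4⟩ := tick_ready io a.go ho hlt
    have hstep : mStep (σ⁻¹ * τ : Equiv.Perm (Fin t)) iz io l a ⟨pm', c', a.gz, d⟩ := by
      refine ⟨hpm', hc', ?_, ?_⟩
      · rw [hx] at hl; rcases hl with rfl | rfl <;> exact gStep_idl_self _ _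
      · rw [hx] at hl; rcases hl with rfl | rfl <;> exact t1
    obtain ⟨x', r', e1, h'⟩ := inv_adv h hl hstep
    obtain ⟨rfl, rfl⟩ := List.cons.inj e1
    obtain ⟨q1, q2⟩ := run_go (τ := τ) (iz := iz) v t2 _ _ _ h'
    exact ⟨l :: v.map .go, _, ⟨_, hstep, q1⟩, fin _ _ q2, hz, t3⟩

lemma stage_all {n : ℕ} (rest : List (Option (Fin t))) {a : Cfg t s ℓ}
    {dn : List (Option (Fin t))}
    (h : InvD σ n a (dn.map tag) rest) (hz : gReady a.gz) (ho : gReady a.go) :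
    ∃ v b, Run (mStep (σ⁻¹ * τ : Equiv.Perm (Fin t)) iz io) v a b ∧
      InvD σ n b ((dn ++ rest).map tag) [] ∧ gReady b.gz ∧ gReady b.go := by
  induction rest generalizing a dn with
  | nil => exact ⟨[], a, rfl, by simpa using h, hz, ho⟩
  | cons x rest ih =>
    obtain ⟨v, b, h1, h2, h3, h4⟩ := stage_adv (τ := τ) (iz := iz) (io := io) h hz ho
    obtain ⟨v', b', k1, k2, k3, k4⟩ := ih h2 h3 h4
    exact ⟨v ++ v', b', h1.append k1, by simpa using k2, k3, k4⟩

/-- Macro configurations. -/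
def Mac (σ : Equiv.Perm (Fin t)) (iz io : Fin (ℓ + 1) → Bool) (n : ℕ) (a : Cfg t s ℓ) : Prop :=
  InvD σ n a [] (seq s σ n) ∧ a.c = .st ∧ a.gz = ⟨iz, 0, false⟩ ∧ a.go = ⟨io, 0, false⟩

lemma mac_step (hτ : pass^[Cc t s - 1] (alpha t s) = top s τ)
    (hiz : bval iz + (s + 1) = 2 ^ (ℓ + 1)) (hio : bval io + t = 2 ^ (ℓ + 1))
    {n : ℕ} {a : Cfg t s ℓ} (h : Mac σ iz io n a) :
    ∃ v b, v ≠ [] ∧ Run (mStep (σ⁻¹ * τ : Equiv.Perm (Fin t)) iz io) v a b ∧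
      Mac σ iz io (n + 1) b := by
  obtain ⟨h, hc, hz, ho⟩ := h
  by_cases htop : IsTop (seq s σ n)
  · obtain ⟨e1, -⟩ := seq_top σ τ hτ n htop
    have hrep : Rep a.pm (seq s σ n ++ [none]) := by simpa [scan] using h.hrep
    have hmain : ∀ u, ∃ p,
        mainAct (s := s) (σ⁻¹ * τ : Equiv.Perm (Fin t)) .W (a.pm u) = some p := by
      intro u
      have hlt : (a.pm u).1 < t := by
        by_contra hn
        have := (hrep.2 u (a.pm u)).2 rfl
        rw [e1, top] at this
        simp [List.getElem?_append, hn] at this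
        split_ifs at this <;> simp_all [List.getElem?_cons]
      simp [mainAct, hlt]
    choose pm' hpm' using hmain
    have hstep : mStep (σ⁻¹ * τ : Equiv.Perm (Fin t)) iz io .W a ⟨pm', .st, a.gz, a.go⟩ :=
      ⟨hpm', by simp [ctlAct, hc], gStep_idl_self _ _, gStep_idl_self _ _⟩
    obtain ⟨k1, k2, k3, k4⟩ := inv_W hτ h hstep
    exact ⟨[.W], _, by simp, ⟨_, hstep, rfl⟩, k1, k2, k3.trans hz, k4.trans ho⟩
  · obtain ⟨v, b, r1, r2, r3, r4⟩ := stage_all (τ := τ) (iz := iz) (io := io) (seq s σ n)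
      (dn := []) h (by rw [hz]; exact Or.inl ⟨rfl, rfl⟩) (by rw [ho]; exact Or.inl ⟨rfl, rfl⟩)
    rw [List.nil_append] at r2
    have hv := seq_valid (s := s) σ n
    have hs1 := hv.shape
    have hs2 := hv.shape'
    have hcz := r2.hcnt.hz
    have hco := r2.hcnt.ho
    rw [map_fst_tag] at hcz hco
    have hctl := (hv.pass htop).2.2
    have hbc := r2.hc
    have hmain : ∀ u, ∃ p,
        mainAct (s := s) (σ⁻¹ * τ : Equiv.Perm (Fin t)) .E (b.pm u) = some p := by
      intro u
      have hne : (b.pm u).1 ≠ 0 := by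
        intro h0
        have := (r2.hrep.2 u (b.pm u)).2 rfl
        rw [h0] at this
        have ho := (scan_out ((seq s σ n).map tag)).2
          (by rcases hctl with hh | hh <;> rw [hh] <;> simp)
        cases hh : (scan ((seq s σ n).map tag)).2.2 with
        | nil => rw [hh] at ho; simp at ho
        | cons y oo =>
          rw [hh] at ho this
          simp at ho this
          rw [ho] at this
          simp at this
      simp only [mainAct]
      rw [if_neg hne]
      split_ifs
      · exact ⟨_, rfl⟩
      · exact ⟨_, rfl⟩
    choose pm' hpm' using hmain
    have hstep : mStep (σ⁻¹ * τ : Equiv.Perm (Fin t)) iz io .E b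
        ⟨pm', .st, ⟨iz, 0, false⟩, ⟨io, 0, false⟩⟩ := by
      refine ⟨hpm', ?_, ?_, ?_⟩
      · rw [← hbc]; simp [ctlAct, hctl]
      · exact (gStep_iff _ _ _ _).2 ⟨gReady_rho r3 (by omega), rfl⟩
      · exact (gStep_iff _ _ _ _).2 ⟨gReady_rho r4 (by omega), rfl⟩
    obtain ⟨k1, k2, k3, k4⟩ := inv_E hiz hio r2 hstep
    exact ⟨v ++ [.E], _, by simp, r1.append ⟨_, hstep, rfl⟩, k1, k2, k3, k4⟩

lemma mac_run (hτ : pass^[Cc t s - 1] (alpha t s) = top s τ)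
    (hiz : bval iz + (s + 1) = 2 ^ (ℓ + 1)) (hio : bval io + t = 2 ^ (ℓ + 1))
    {a : Cfg t s ℓ} (h : Mac σ iz io 0 a) (n : ℕ) :
    ∃ v b, (n ≠ 0 → v ≠ []) ∧ Run (mStep (σ⁻¹ * τ : Equiv.Perm (Fin t)) iz io) v a b ∧
      Mac σ iz io n b := by
  induction n with
  | zero => exact ⟨[], a, by simp, rfl, h⟩
  | succ n ih =>
    obtain ⟨v, b, -, h1, h2⟩ := ih
    obtain ⟨v', b', k0, k1, k2⟩ := mac_step hτ hiz hio h2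
    exact ⟨v ++ v', b', by simp [k0], h1.append k1, k2⟩

lemma mac_zero (hiz : bval iz + (s + 1) = 2 ^ (ℓ + 1)) (hio : bval io + t = 2 ^ (ℓ + 1)) :
    Mac σ iz io 0 (⟨fun u : Fin t => (⟨u.1 + 1, by omega⟩ : Fin (t + s + 2)), .st,
      ⟨iz, 0, false⟩, ⟨io, 0, false⟩⟩ : Cfg t s ℓ) := by
  have e : seq s σ 0 = alpha t s := by simp [seq]
  refine ⟨⟨by simp, by simp, rfl, ?_, cnt_start hiz hio⟩, rfl, rfl, rfl⟩
  rw [e]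
  simpa [scan] using rep_alpha (t := t) (s := s)

/-- States of the whole machine. -/
abbrev MQ (t s ℓ : ℕ) := Fin (t + s + 2) ⊕ Ctl ⊕ GQ ℓ ⊕ GQ ℓ ⊕ Option Letter

/-- Tokens of the whole machine. -/
abbrev MT (t ℓ : ℕ) := Fin t ⊕ Unit ⊕ GT ℓ ⊕ GT ℓ

/-- Action of the letters. -/
def mAct (w : Fin t → Fin t) (iz io : Fin (ℓ + 1) → Bool) (l : Letter) :
    MQ t s ℓ → Option (MQ t s ℓ)
  | .inl i => (mainAct w l i).map .inl
  | .inr (.inl c) => (ctlAct l c).map (fun x => .inr (.inl x))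
  | .inr (.inr (.inl g)) => (gAct iz (opz l) g).map (fun x => .inr (.inr (.inl x)))
  | .inr (.inr (.inr (.inl g))) => (gAct io (opo l) g).map (fun x => .inr (.inr (.inr (.inl x))))
  | .inr (.inr (.inr (.inr _))) => some (.inr (.inr (.inr (.inr (some l)))))

/-- Positions of the tokens. -/
def mPos (a : Cfg t s ℓ) : MT t ℓ → MQ t s ℓ
  | .inl u => .inl (a.pm u)
  | .inr (.inl _) => .inr (.inl a.c)
  | .inr (.inr (.inl k)) => .inr (.inr (.inl (gPos a.gz k)))
  | .inr (.inr (.inr k)) => .inr (.inr (.inr (.inl (gPos a.go k))))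

theorem machine (t s ℓ : ℕ) (σ : Equiv.Perm (Fin t)) (hs : s + 1 ≤ 2 ^ (ℓ + 1))
    (ht : t ≤ 2 ^ (ℓ + 1)) (ht0 : 0 < t) (hN : 1 < Cc t s) :
    ∃ A : Finset (Fin (Fintype.card (MQ t s ℓ)) → Option (Fin (Fintype.card (MQ t s ℓ)))),
      A.card = Fintype.card Letter ∧
      ∃ f, (∃ w, Expresses A w f) ∧
        (∀ w, Expresses A w f → Cc t s * orderOf σ - 1 ≤ w.length) := by
  obtain ⟨τ, hτ⟩ := exists_tau t s
  obtain ⟨iz, hiz⟩ := exists_bval (ℓ := ℓ) (2 ^ (ℓ + 1) - (s + 1)) (by omega)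
  obtain ⟨io, hio⟩ := exists_bval (ℓ := ℓ) (2 ^ (ℓ + 1) - t) (by omega)
  have hiz' : bval iz + (s + 1) = 2 ^ (ℓ + 1) := by omega
  have hio' : bval io + t = 2 ^ (ℓ + 1) := by omega
  have h0 := mac_zero (σ := σ) hiz' hio'
  obtain ⟨v, b, hv, hrun, hb⟩ := mac_run hτ hiz' hio' h0 (Cc t s * orderOf σ - 1)
  have hg : 0 < orderOf σ := orderOf_pos σ
  have hne : Cc t s * orderOf σ - 1 ≠ 0 := by
    have := Nat.mul_le_mul hN hg
    omega
  refine bridge (mAct (σ⁻¹ * τ : Equiv.Perm (Fin t)) iz io) ?_ mPos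
    (mStep (σ⁻¹ * τ : Equiv.Perm (Fin t)) iz io) ?_ ?_ ?_ _ b v (hv hne) hrun _ ?_
  · intro l l' hll
    have := congrFun hll (.inr (.inr (.inr (.inr none))))
    simpa [mAct] using this
  · rintro l a a' ⟨s1, s2, s3, s4⟩ (u | _ | k | k)
    · simp only [mAct, mPos, s1 u, Option.map_some]
    · simp [mAct, mPos, s2]
    · simp [mAct, mPos, s3 k]
    · simp [mAct, mPos, s4 k]
  · intro l a hall
    have k1 : ∀ u, ∃ p, mainAct (s := s) (σ⁻¹ * τ : Equiv.Perm (Fin t)) l (a.pm u) = some p := by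
      intro u
      have := hall (.inl u)
      simp only [mAct, mPos, ne_eq, Option.map_eq_none_iff] at this
      exact Option.ne_none_iff_exists'.1 this
    have k2 : ∃ c, ctlAct l a.c = some c := by
      have := hall (.inr (.inl ()))
      simp only [mAct, mPos, ne_eq, Option.map_eq_none_iff] at this
      exact Option.ne_none_iff_exists'.1 this
    have k3 : gLive (opz l) a.gz := gLive_of iz _ _ fun k => by
      have := hall (.inr (.inr (.inl k)))
      simpa only [mAct, mPos, ne_eq, Option.map_eq_none_iff] using this
    have k4 : gLive (opo l) a.go := gLive_of io _ _ fun k => by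
      have := hall (.inr (.inr (.inr k)))
      simpa only [mAct, mPos, ne_eq, Option.map_eq_none_iff] using this
    choose pm' hpm' using k1
    obtain ⟨c', hc'⟩ := k2
    exact ⟨⟨pm', c', _, _⟩, hpm', hc', gStep_next iz _ _ k3, gStep_next io _ _ k4⟩
  · intro a a' haa
    refine Cfg.ext ?_ ?_ ?_ ?_
    · funext u
      simpa [mPos] using haa (.inl u)
    · simpa [mPos] using haa (.inr (.inl ()))
    · exact gPos_inj fun k => by simpa [mPos] using haa (.inr (.inr (.inl k)))
    · exact gPos_inj fun k => by simpa [mPos] using haa (.inr (.inr (.inr k)))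
  · intro v' hv'
    obtain ⟨m, D, rest, hI, hm⟩ := inv_run hτ hiz' hio' v' h0.1 hv'
    have hD : D = [] := scan_st D (by rw [hI.hc, hb.2.1])
    subst hD
    have e1 : rest = seq s σ m := by simpa using hI.hseq.symm
    subst e1
    have hr1 := hI.hrep
    have hr2 := hb.1.hrep
    have hr1' : Rep b.pm (seq s σ m ++ [none]) := by simpa [scan] using hr1
    have hr2' : Rep b.pm (seq s σ (Cc t s * orderOf σ - 1) ++ [none]) := by
      simpa [scan] using hr2
    have heq : seq s σ m = seq s σ (Cc t s * orderOf σ - 1) := by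
      apply List.ext_getElem
      · rw [(seq_valid σ m).length, (seq_valid σ _).length]
      · intro i i1 i2
        have hl := (seq_valid (s := s) σ m).length
        have q1 := fun u => hr1'.2 u ⟨i, by omega⟩
        have q2 := fun u => hr2'.2 u ⟨i, by omega⟩
        simp only [List.getElem?_append_left i1] at q1
        simp only [List.getElem?_append_left i2] at q2
        rw [List.getElem?_eq_getElem i1] at q1
        rw [List.getElem?_eq_getElem i2] at q2
        apply Option.ext
        intro u
        have := (q1 u).trans (q2 u).symm
        simpa using this
    have := seq_final σ m heq
    omega

lemma card_MQ (t s ℓ : ℕ) : Fintype.card (MQ t s ℓ) = t + s + 6 * ℓ + 30 := by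
  have h1 : Fintype.card Ctl = 5 := rfl
  have h2 : Fintype.card Letter = 12 := rfl
  simp only [MQ, GQ, Fintype.card_sum, Fintype.card_fin, Fintype.card_prod, Fintype.card_bool,
    Fintype.card_option, h1, h2]
  ring

end complete

end Diam

/-- There exist constants `m` and `C` such that for every `k ≥ 1` there are a state set of
size `n ≤ 2k + C·(log₂(2k + 1) + 1)`, an alphabet of `m` partial transformations of it, and
a partial transformation `f` expressed by some nonempty word over it, such that every
nonempty word expressing `f` has length at least `(2k choose k) · g(k)`, where `g` is the
Landau function. This yields the tight lower bound `2^n · e^((1 + o(1))·√((n/2)·log n))` on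
the maximum diameter for a constant-size alphabet. -/
theorem diam_lower_bound_constant_alphabet :
    ∃ m C : ℕ, ∀ k : ℕ, 1 ≤ k →
      ∃ n : ℕ, n ≤ 2 * k + C * (Nat.log 2 (2 * k + 1) + 1) ∧
        ∃ A : Finset (Fin n → Option (Fin n)),
          A.card = m ∧
          ∃ f : Fin n → Option (Fin n),
            (∃ w, Expresses A w f) ∧
            (∀ w, Expresses A w f → Nat.choose (2 * k) k * landau k ≤ w.length) := by
  refine ⟨Fintype.card Diam.Letter, 30, fun k hk => ?_⟩
  obtain ⟨σ, -, hσ⟩ := Finset.exists_mem_eq_sup (Finset.univ : Finset (Equiv.Perm (Fin k)))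
    Finset.univ_nonempty (fun σ : Equiv.Perm (Fin k) => orderOf σ)
  have hσ' : landau k = orderOf σ := hσ
  have hlog : 2 * k + 1 < 2 ^ (Nat.log 2 (2 * k + 1) + 1) :=
    Nat.lt_pow_succ_log_self (by norm_num) _
  have hC : Diam.Cc k k = (2 * k).choose k + (2 * k).choose (k - 1) := by
    obtain ⟨j, rfl⟩ : ∃ j, k = j + 1 := ⟨k - 1, by omega⟩
    have e : j + 1 + (j + 1) + 1 = 2 * (j + 1) + 1 := by omega
    rw [Diam.Cc, e, Nat.choose_succ_succ', Nat.add_sub_cancel, add_comm]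
  have hpos : 0 < (2 * k).choose (k - 1) := Nat.choose_pos (by omega)
  have hpos' : 0 < (2 * k).choose k := Nat.choose_pos (by omega)
  have hg : 0 < orderOf σ := orderOf_pos σ
  obtain ⟨A, hA, f, hf, hmin⟩ := Diam.machine k k (Nat.log 2 (2 * k + 1)) σ (by omega) (by omega)
    hk (by omega)
  refine ⟨_, ?_, A, hA, f, hf, fun w hw => ?_⟩
  · rw [Diam.card_MQ]; omega
  · refine le_trans ?_ (hmin w hw)
    rw [hσ', hC, Nat.add_mul]
    have := Nat.mul_le_mul hpos hg
    omega
end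

section
/- There exist constants m and C such that for every integer k ≥ 1 there exist a natural number n ≤ 2k + C·(Nat.log 2 (2k + 1) + 1), a set A of m partial transformations of an n-element set, and words w₁, w₂, …, w_ℓ over A with ℓ = binom(2k, k), such that for all indices h' < h ≤ ℓ and every word u over A, the partial transformation expressed by the concatenation w₁w₂⋯w_h u is not equal to the partial transformation expressed by w₁w₂⋯w_{h'}. (This yields a transformation semigroup with a chain of R-classes of length binom(2k, k).) -/
/-- Control stages of a pass over the tape. -/
inductive Stage
  | e0 | e1 | r | d | done
  deriving DecidableEq

instance : Fintype Stage := ⟨{.e0, .e1, .r, .d, .done}, by intro x; cases x <;> simp⟩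

/-- The four operations on the tape. -/
inductive Kind
  | k0 | k1 | ra | dr
  deriving DecidableEq

instance : Fintype Kind := ⟨{.k0, .k1, .ra, .dr}, by intro x; cases x <;> simp⟩

/-- Effect of a tape operation on the control stage. -/
def ksm : Kind → Stage → Option Stage
  | .k0, s => some s
  | .k1, .e0 => some .e1
  | .k1, .e1 => some .e0
  | .k1, s => some s
  | .ra, .e0 => some .r
  | .ra, .d => some .done
  | .ra, _ => none
  | .dr, .e1 => some .d
  | .dr, .r => some .done
  | .dr, _ => none

/-- The guessed bit. -/
def kin : Kind → Bool
  | .k0 => false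
  | .k1 => true
  | .ra => false
  | .dr => true

/-- The bit written by an honest operation. -/
def kout : Kind → Bool
  | .k0 => false
  | .k1 => true
  | .ra => true
  | .dr => false

/-- Honest passes. -/
inductive Tr : List Bool → List Bool → Stage → Stage → Prop
  | nil (s) : Tr [] [] s s
  | cons {x y s s1 s'} (a : Kind) (h : ksm a s = some s1) (t : Tr x y s1 s') :
      Tr (kin a :: x) (kout a :: y) s s'

theorem Tr.len {x y s s'} (h : Tr x y s s') : x.length = y.length := by
  induction h with
  | nil => rfl
  | cons a h t ih => simp [ih]

/-- Starting stage for a given parity. -/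
def est : Bool → Stage
  | false => .e0
  | true => .e1

/-- Rank in the reflected Gray code. -/
def gval : Bool → List Bool → ℕ
  | _, [] => 0
  | p, b :: l => (if xor p b then 2 ^ l.length else 0) + gval (xor p b) l

theorem gval_lt (p : Bool) (l : List Bool) : gval p l < 2 ^ l.length := by
  induction l generalizing p with
  | nil => simp [gval]
  | cons b l ih =>
    have := ih (xor p b)
    simp only [gval, List.length_cons, pow_succ]
    split_ifs <;> omega

theorem gval_append_lt (p : Bool) (x a b : List Bool) (h : a.length = b.length) :
    gval p (x ++ a) < gval p (x ++ b) ↔ gval (x.foldl xor p) a < gval (x.foldl xor p) b := by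
  induction x generalizing p with
  | nil => simp
  | cons c x ih =>
    simp only [List.cons_append, gval, List.length_append, h, List.foldl_cons]
    rw [← ih]
    omega

theorem gval_flip (p : Bool) (a b : List Bool) (h : a.length = b.length) :
    gval p (p :: a) < gval p ((!p) :: b) := by
  have := gval_lt false a
  rw [h] at this
  cases p <;> simp [gval] <;> omega

theorem Tr.gval_lt {x y s s'} (h : Tr x y s s') :
    ∀ p, s = est p → s' = .done → gval p x < gval p y := by
  induction h with
  | nil s => intro p hp hd; subst hp; cases p <;> simp [est] at hd
  | cons a h t ih =>
    intro p hp hd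
    subst hp
    have hl := t.len
    cases p <;> cases a <;> simp [ksm, est] at h <;> subst h <;> simp only [kin, kout]
    · have := ih false rfl hd
      simp [gval, this]
    · have := ih true rfl hd
      simp [gval, this, hl]
    · exact gval_flip false _ _ hl
    · have := ih true rfl hd
      simp [gval, this, hl]
    · have := ih false rfl hd
      simp [gval, this]
    · exact gval_flip true _ _ hl

/-- `a` zeros followed by `b` ones. -/
def wA (a b : ℕ) : List Bool := List.replicate a false ++ List.replicate b true

/-- The other extreme word. -/
def wB (a : ℕ) : ℕ → List Bool
  | 0 => List.replicate a false
  | b + 1 => true :: wA a b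

theorem Tr.refl_rep (n : ℕ) (b : Bool) (s : Stage) (hs : b = false ∨ s = .r ∨ s = .d ∨ s = .done)
    {x y s'} (h : Tr x y s s') :
    Tr (List.replicate n b ++ x) (List.replicate n b ++ y) s s' := by
  induction n with
  | zero => simpa
  | succ n ih =>
    rw [List.replicate_succ, List.cons_append, List.cons_append]
    cases b
    · exact Tr.cons .k0 (by rfl) ih
    · refine Tr.cons .k1 (s1 := s) ?_ ih
      rcases hs with h | h | h | h
      · simp at h
      all_goals subst h; rfl

theorem Tr.refl_rep' (n : ℕ) (b : Bool) :
    Tr (List.replicate n b) (List.replicate n b) .done .done := by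
  have := Tr.refl_rep n b .done (by simp) (Tr.nil _)
  simpa using this

theorem trB_drop (a b : ℕ) : Tr (wB a (b + 1)) (wB (a + 1) b) .r .done := by
  cases b with
  | zero =>
    simp only [wB, wA, List.replicate_zero, List.append_nil, List.replicate_succ]
    exact Tr.cons .dr rfl (Tr.refl_rep' _ _)
  | succ b =>
    simp only [wB, wA]
    refine Tr.cons .k1 (s1 := .r) rfl ?_
    rw [List.replicate_succ' (n := a), List.append_assoc]
    refine Tr.refl_rep a false .r (by simp) ?_
    rw [List.replicate_succ]
    exact Tr.cons .dr rfl (Tr.refl_rep' _ _)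

theorem trB_raise (a b : ℕ) : Tr (wB (a + 1) b) (wB a (b + 1)) .d .done := by
  cases b with
  | zero =>
    simp only [wB, wA, List.replicate_zero, List.append_nil, List.replicate_succ]
    exact Tr.cons .ra rfl (Tr.refl_rep' _ _)
  | succ b =>
    simp only [wB, wA]
    refine Tr.cons .k1 (s1 := .d) rfl ?_
    rw [List.replicate_succ' (n := a), List.append_assoc]
    refine Tr.refl_rep a false .d (by simp) ?_
    rw [List.replicate_succ (n := b)]
    exact Tr.cons .ra rfl (Tr.refl_rep' _ _)

theorem chain_glue {p : Bool} {c c' q q' : Bool} {L L' : List (List Bool)} {z z' : List Bool}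
    (hc : ∀ x y, Tr x y (est q) .done → Tr (c :: x) (c :: y) (est p) .done)
    (hc' : ∀ x y, Tr x y (est q') .done → Tr (c' :: x) (c' :: y) (est p) .done)
    (hL : L.IsChain (fun x y => Tr x y (est q) .done))
    (hL' : L'.IsChain (fun x y => Tr x y (est q') .done))
    (hz : L.getLast? = some z) (hz' : L'.head? = some z')
    (hzz : Tr (c :: z) (c' :: z') (est p) .done) :
    (L.map (List.cons c) ++ L'.map (List.cons c')).IsChain
      (fun x y => Tr x y (est p) .done) := by
  rw [List.isChain_append]
  refine ⟨?_, ?_, ?_⟩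
  · rw [List.isChain_map]; exact hL.imp hc
  · rw [List.isChain_map]; exact hL'.imp hc'
  · intro x hx y hy
    simp [List.getLast?_map, List.head?_map, hz, hz'] at hx hy
    subst hx; subst hy; exact hzz

/-- The revolving door enumeration. -/
theorem revolving (a : ℕ) : ∀ b : ℕ,
    (∃ L : List (List Bool), L.length = (a + b).choose b ∧
      (∀ x ∈ L, x.count false = a ∧ x.count true = b) ∧
      L.IsChain (fun x y => Tr x y (est false) .done) ∧
      L.head? = some (wA a b) ∧ L.getLast? = some (wB a b)) ∧
    (∃ L : List (List Bool), L.length = (a + b).choose b ∧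
      (∀ x ∈ L, x.count false = a ∧ x.count true = b) ∧
      L.IsChain (fun x y => Tr x y (est true) .done) ∧
      L.head? = some (wB a b) ∧ L.getLast? = some (wA a b)) := by
  induction a with
  | zero =>
    intro b
    have h : wB 0 b = wA 0 b := by cases b <;> simp [wA, wB, List.replicate_succ]
    rw [h]
    refine ⟨⟨[wA 0 b], ?_⟩, ⟨[wA 0 b], ?_⟩⟩ <;> simp [wA, List.count_replicate]
  | succ a iha =>
    intro b
    induction b with
    | zero =>
      have h : wB (a + 1) 0 = wA (a + 1) 0 := by simp [wA, wB]
      rw [h]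
      refine ⟨⟨[wA (a + 1) 0], ?_⟩, ⟨[wA (a + 1) 0], ?_⟩⟩ <;> simp [wA, List.count_replicate]
    | succ b ihb =>
      obtain ⟨⟨L0, l0, m0, c0, h0, t0⟩, ⟨L1, l1, m1, c1, h1, t1⟩⟩ := iha (b + 1)
      obtain ⟨⟨K0, l0', m0', c0', h0', t0'⟩, ⟨K1, l1', m1', c1', h1', t1'⟩⟩ := ihb
      have hch : (a + 1 + (b + 1)).choose (b + 1)
          = (a + 1 + b).choose b + (a + (b + 1)).choose (b + 1) := by
        rw [show a + 1 + (b + 1) = (a + 1 + b) + 1 by ring, Nat.choose_succ_succ]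
        congr 2; ring
      have hmem : ∀ (L K : List (List Bool)),
          (∀ x ∈ L, x.count false = a ∧ x.count true = b + 1) →
          (∀ x ∈ K, x.count false = a + 1 ∧ x.count true = b) →
          ∀ x, (x ∈ L.map (List.cons false) ∨ x ∈ K.map (List.cons true)) →
           x.count false = a + 1 ∧ x.count true = b + 1 := by
        intro L K hL hK x hx
        simp only [List.mem_map] at hx
        rcases hx with ⟨y, hy, rfl⟩ | ⟨y, hy, rfl⟩
        · have := hL y hy; simp [this]
        · have := hK y hy; simp [this]
      constructor
      · refine ⟨L0.map (List.cons false) ++ K1.map (List.cons true), ?_, ?_, ?_, ?_, ?_⟩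
        · simp [l0, l1', hch]; ring
        · intro x hx
          exact hmem L0 K1 m0 m1' x (by simpa using hx)
        · refine chain_glue (q := false) (q' := true) ?_ ?_ c0 c1' t0 h1' ?_
          · intro x y h; exact Tr.cons .k0 rfl h
          · intro x y h; exact Tr.cons .k1 rfl h
          · exact Tr.cons .ra rfl (trB_drop a b)
        · simp [List.head?_append, h0, wA, List.replicate_succ]
        · simp [List.getLast?_append, List.getLast?_map, t1', wB]
      · refine ⟨K0.map (List.cons true) ++ L1.map (List.cons false), ?_, ?_, ?_, ?_, ?_⟩
        · simp [l0', l1, hch]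
        · intro x hx
          refine hmem L1 K0 m1 m0' x ?_
          rw [List.mem_append] at hx; exact hx.symm
        · refine chain_glue (q := false) (q' := true) ?_ ?_ c0' c1 t0' h1 ?_
          · intro x y h; exact Tr.cons .k1 rfl h
          · intro x y h; exact Tr.cons .k0 rfl h
          · exact Tr.cons .dr rfl (trB_raise a b)
        · simp [List.head?_append, h0', wB]
        · simp [List.getLast?_append, List.getLast?_map, t1, wA, List.replicate_succ]


/-! ### Abstract soundness invariant -/

/-- `y` is already known to be larger than `x` in the Gray order. -/
def GGt (x y : List Bool) : Prop :=
  ∀ z z' : List Bool, z.length = z'.length → gval false (x ++ z) < gval false (y ++ z')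

/-- Relation between the scanned part, the written part, the stage and the hold cells. -/
def GRel (st : Stage) (h0 h1 : Bool) (x y : List Bool) : Prop :=
  match st with
  | .e0 => y = x ∧ x.foldl xor false = false ∧ h0 = true ∧ h1 = false
  | .e1 => y = x ∧ x.foldl xor false = true ∧ h0 = true ∧ h1 = false
  | .r => GGt x y ∧ y.count true = x.count true + 1 ∧ h0 = false ∧ h1 = false
  | .d => GGt x y ∧ y.count true + 1 = x.count true ∧ h0 = true ∧ h1 = true
  | .done => GGt x y ∧ y.count true = x.count true ∧ h0 = true ∧ h1 = false

/-- Doomed configurations. -/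
def ABad (k e f : ℕ) (t : List Bool) : Prop :=
  k < e ∨ k < f ∨ ∃ x2 y, t = x2 ++ y ∧ x2.length + e + f = 2 * k ∧ k < f + x2.count true

/-- Configurations in the middle of an honest pass started at `x`. -/
def AGood (x : List Bool) (st : Stage) (h0 h1 : Bool) (e f : ℕ) (t : List Bool) : Prop :=
  ∃ x1 x2 y, x = x1 ++ x2 ∧ t = x2 ++ y ∧ f = x1.count true ∧ e = x1.count false ∧
    x1.length = y.length ∧ GRel st h0 h1 x1 y

/-- The invariant. -/
def AInv (k v : ℕ) (st : Stage) (h0 h1 : Bool) (e f : ℕ) (t : List Bool) : Prop :=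
  ABad k e f t ∨ ∃ x, x.length = 2 * k ∧ x.count true = k ∧ v ≤ gval false x ∧
    AGood x st h0 h1 e f t

/-- The bit that is pushed. -/
def kpush : Kind → Bool → Bool → Bool
  | .k0, _, _ => false
  | .k1, b, _ => b
  | .ra, _, h0 => h0
  | .dr, _, _ => false

/-- New first hold cell. -/
def kh0 : Kind → Bool → Bool → Bool → Bool
  | .k0, _, h0, _ => h0
  | .k1, _, h0, _ => h0
  | .ra, _, _, h1 => h1
  | .dr, b, _, _ => b

/-- New second hold cell. -/
def kh1 : Kind → Bool → Bool → Bool → Bool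
  | .k0, _, _, h1 => h1
  | .k1, _, _, h1 => h1
  | .ra, _, _, _ => false
  | .dr, _, h0, _ => h0

theorem ABad.step {k e f b l} (b' : Bool) (a : Kind) (hg : kin a = false → b = false)
    (hb : ABad k e f (b :: l)) :
    ABad k (if kin a then e else e + 1) (if kin a then f + 1 else f) (l ++ [b']) := by
  rcases hb with h | h | ⟨x2, y, ht, hl, hk⟩
  · left; split_ifs <;> omega
  · right; left; split_ifs <;> omega
  · by_cases he : k < e
    · left; split_ifs <;> omega
    by_cases hf : k < f
    · right; left; split_ifs <;> omega
    cases x2 with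
    | nil => simp at hk; omega
    | cons c x2 =>
      simp only [List.cons_append, List.cons.injEq] at ht
      obtain ⟨rfl, rfl⟩ := ht
      right; right
      refine ⟨x2, y ++ [b'], by simp, ?_, ?_⟩
      · simp at hl; split_ifs <;> omega
      · cases hka : kin a
        · have := hg hka; subst this
          simpa using hk
        · have : List.count true (b :: x2) ≤ x2.count true + 1 := by
            rw [List.count_cons]; split_ifs <;> omega
          simp; omega

theorem GGt.app {x y : List Bool} (h : GGt x y) (b c : Bool) : GGt (x ++ [b]) (y ++ [c]) := by
  intro z z' hz
  have := h (b :: z) (c :: z') (by simp [hz])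
  simpa using this

theorem GGt.new {x : List Bool} (p : Bool) (h : x.foldl xor false = p) :
    GGt (x ++ [p]) (x ++ [!p]) := by
  intro z z' hz
  rw [List.append_assoc, List.append_assoc, gval_append_lt _ _ _ _ (by simp [hz]), h]
  exact gval_flip p z z' hz

theorem GRel.step {st st' : Stage} {h0 h1 : Bool} {x y : List Bool} (a : Kind)
    (hs : ksm a st = some st') (hR : GRel st h0 h1 x y) :
    GRel st' (kh0 a (kin a) h0 h1) (kh1 a (kin a) h0 h1) (x ++ [kin a])
      (y ++ [kpush a (kin a) h0]) := by
  cases a <;> cases st <;> simp [ksm] at hs <;> subst hs <;>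
    simp only [GRel] at hR <;> simp only [GRel, kin, kh0, kh1, kpush]
  case k0.e0 => obtain ⟨rfl, h, rfl, rfl⟩ := hR; simp [h]
  case k0.e1 => obtain ⟨rfl, h, rfl, rfl⟩ := hR; simp [h]
  case k1.e0 => obtain ⟨rfl, h, rfl, rfl⟩ := hR; simp [h]
  case k1.e1 => obtain ⟨rfl, h, rfl, rfl⟩ := hR; simp [h]
  case ra.e0 => obtain ⟨rfl, h, rfl, rfl⟩ := hR; exact ⟨GGt.new false h, by simp, by simp, by simp⟩
  case dr.e1 => obtain ⟨rfl, h, rfl, rfl⟩ := hR; exact ⟨GGt.new true h, by simp, by simp, by simp⟩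
  all_goals
    obtain ⟨hG, h, rfl, rfl⟩ := hR
    exact ⟨hG.app _ _, by simp; omega, by simp, by simp⟩

theorem AInv.step {k v e f b l h0 h1} {st st' : Stage} (a : Kind)
    (hlen : (b :: l).length = 2 * k)
    (hs : ksm a st = some st') (hg : kin a = false → b = false)
    (hI : AInv k v st h0 h1 e f (b :: l)) :
    AInv k v st' (kh0 a b h0 h1) (kh1 a b h0 h1) (if kin a then e else e + 1)
      (if kin a then f + 1 else f) (l ++ [kpush a b h0]) := by
  rcases hI with hB | ⟨x, hx, hk, hv, x1, x2, y, rfl, ht, rfl, rfl, hl, hR⟩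
  · left; exact hB.step _ a hg
  cases x2 with
  | nil =>
    have := List.count_true_add_count_false (l := x1)
    simp at hk hx
    left
    cases kin a
    · left; simp; omega
    · right; left; simp; omega
  | cons c x2 =>
    simp only [List.cons_append, List.cons.injEq] at ht
    obtain ⟨rfl, rfl⟩ := ht
    by_cases hb : b = kin a
    · subst hb
      right
      refine ⟨_, hx, hk, hv, x1 ++ [kin a], x2, y ++ [kpush a (kin a) h0], by simp, by simp,
        ?_, ?_, by simp [hl], hR.step a hs⟩
      · cases kin a <;> simp
      · cases kin a <;> simp
    · have hka : kin a = true := by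
        cases h : kin a
        · have := hg h; simp_all
        · rfl
      rw [hka] at hb
      simp at hb; subst hb
      left; right; right
      refine ⟨x2, y ++ [kpush a false h0], by simp, ?_, ?_⟩
      · have := List.count_true_add_count_false (l := x1)
        simp at hx
        simp [hka]; omega
      · simp at hk
        simp [hka]; omega

theorem AInv.fin {k v h0 h1 t} (hI : AInv k v .done h0 h1 k k t) :
    AInv k v .e0 h0 h1 0 0 t := by
  rcases hI with hB | ⟨x, hx, hk, hv, x1, x2, y, rfl, rfl, hf, he, hl, hR⟩
  · exfalso
    rcases hB with h | h | ⟨x2, y, _, hl, h⟩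
    · omega
    · omega
    · have : x2 = [] := List.eq_nil_of_length_eq_zero (by omega)
      subst this; simp at h
  · have := List.count_true_add_count_false (l := x1)
    have : x2 = [] := List.eq_nil_of_length_eq_zero (by simp at hx; omega)
    subst this
    obtain ⟨hG, hc, rfl, rfl⟩ := hR
    right
    have := hG [] [] rfl
    simp at this hx hk hv
    refine ⟨y, by omega, by omega, by omega, [], y, [], by simp, by simp, by simp, by simp,
      by simp, ?_⟩
    simp [GRel]

theorem AInv.start_val {k v h0 h1 t} (hk : t.length = 2 * k) (hc : t.count true = k)
    (hI : AInv k v .e0 h0 h1 0 0 t) : v ≤ gval false t := by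
  rcases hI with hB | ⟨x, hx, hk, hv, x1, x2, y, rfl, rfl, hf, he, hl, hR⟩
  · exfalso
    rcases hB with h | h | ⟨x2, y, rfl, hl, h⟩
    · omega
    · omega
    · simp at hc; omega
  · have := List.count_true_add_count_false (l := x1)
    have : x1 = [] := List.eq_nil_of_length_eq_zero (by omega)
    subst this
    have : y = [] := List.eq_nil_of_length_eq_zero (by simp at hl; omega)
    subst this
    simpa using hv

theorem AInv.start {k t} (hk : t.length = 2 * k) (hc : t.count true = k) :
    AInv k (gval false t) .e0 true false 0 0 t :=
  Or.inr ⟨t, hk, hc, le_refl _, [], t, [], by simp, by simp, by simp, by simp, by simp,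
    by simp [GRel]⟩

/-! ### Digits -/

/-- Value of a digit string. -/
def dval {r : ℕ} (d : Fin r → Fin 3) : ℕ := ∑ i, (d i).val * 2 ^ i.val

theorem dval_succ {r : ℕ} (d : Fin (r + 1) → Fin 3) :
    dval d = (d 0).val + 2 * dval (fun i => d i.succ) := by
  unfold dval
  rw [Fin.sum_univ_succ, Finset.mul_sum]
  simp [pow_succ]
  apply Finset.sum_congr rfl
  intros; ring

theorem exists_digits (r : ℕ) : ∀ k, k < 2 ^ r → ∃ d : Fin r → Fin 3, (∀ i, d i ≠ 2) ∧
    dval d = k := by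
  induction r with
  | zero => intro k hk; exact ⟨fun _ => 0, by simp, by simp [dval]; simp at hk; omega⟩
  | succ r ih =>
    intro k hk
    obtain ⟨d, h, hv⟩ := ih (k / 2) (by rw [pow_succ] at hk; omega)
    refine ⟨Fin.cons (if k % 2 = 0 then 0 else 1) d, ?_, ?_⟩
    · intro i
      refine Fin.cases ?_ ?_ i
      · simp only [Fin.cons_zero]; split_ifs <;> decide
      · simpa using h
    · rw [dval_succ]
      simp only [Fin.cons_zero, Fin.cons_succ]
      rw [hv]
      split_ifs <;> simp <;> omega

theorem fin3_lt {v : Fin 3} (h : v ≠ 2) : v.val < 2 := by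
  revert v; decide

theorem digits_unique (r : ℕ) : ∀ d d' : Fin r → Fin 3, (∀ i, d i ≠ 2) → (∀ i, d' i ≠ 2) →
    dval d = dval d' → d = d' := by
  induction r with
  | zero => intro d d' _ _ _; exact Subsingleton.elim _ _
  | succ r ih =>
    intro d d' h h' hv
    rw [dval_succ, dval_succ] at hv
    have h0 := fin3_lt (h 0)
    have h0' := fin3_lt (h' 0)
    have := ih _ _ (fun i => h i.succ) (fun i => h' i.succ) (by omega)
    have h00 : d 0 = d' 0 := by apply Fin.ext; omega
    funext i
    refine Fin.cases h00 (fun j => congrFun this j) i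

theorem dval_update {r : ℕ} (d : Fin r → Fin 3) (i : Fin r) (v : Fin 3) :
    dval (Function.update d i v) + (d i).val * 2 ^ i.val = dval d + v.val * 2 ^ i.val := by
  unfold dval
  rw [← Finset.add_sum_erase _ _ (Finset.mem_univ i),
    ← Finset.add_sum_erase (a := i) _ (fun i => (d i).val * 2 ^ i.val) (Finset.mem_univ i)]
  have : ∑ x ∈ Finset.univ.erase i, (Function.update d i v x).val * 2 ^ x.val =
      ∑ x ∈ Finset.univ.erase i, (d x).val * 2 ^ x.val := by
    apply Finset.sum_congr rfl
    intro x hx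
    rw [Function.update_of_ne (Finset.ne_of_mem_erase hx)]
  rw [this]; simp; ring

theorem fin3_inc {v : Fin 3} (h : v ≠ 2) : (v + 1).val = v.val + 1 := by
  revert v; decide

theorem dval_inc {r : ℕ} (d : Fin (r + 1) → Fin 3) (h : d 0 ≠ 2) :
    dval (Function.update d 0 (d 0 + 1)) = dval d + 1 := by
  have := dval_update d 0 (d 0 + 1)
  rw [fin3_inc h] at this
  simp at this; omega

/-- The carry operation at index `i`. -/
def dcarry {r : ℕ} (d : Fin (r + 1) → Fin 3) (i : Fin (r + 1)) : Fin (r + 1) → Fin 3 :=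
  Function.update (Function.update d i 0) (i + 1) (d (i + 1) + 1)

theorem dval_carry {r : ℕ} (d : Fin (r + 1) → Fin 3) (i : Fin (r + 1)) (hi : i ≠ Fin.last r)
    (h2 : d i = 2) (h : d (i + 1) ≠ 2) : dval (dcarry d i) = dval d := by
  have hv : (i + 1).val = i.val + 1 := Fin.val_add_one_of_lt (Fin.lt_last_iff_ne_last.2 hi)
  have hne : i + 1 ≠ i := by intro h; rw [h] at hv; omega
  have e1 := dval_update d i 0
  have e2 := dval_update (Function.update d i 0) (i + 1) (d (i + 1) + 1)
  rw [Function.update_of_ne hne, fin3_inc h, hv] at e2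
  rw [h2] at e1
  unfold dcarry
  simp at e1
  rw [pow_succ] at e2
  nlinarith


/-! ### The machine -/

/-- Letters. -/
inductive Letter
  | rho
  | car (w : Bool)
  | tap (a : Kind)
  | fin
  deriving DecidableEq

instance : Fintype Letter :=
  ⟨{.rho, .car false, .car true, .tap .k0, .tap .k1, .tap .ra, .tap .dr, .fin}, by
    intro x
    rcases x with _ | w | a | _
    · simp
    · cases w <;> simp
    · cases a <;> simp
    · simp⟩

/-- States. -/
inductive Pt (R M : ℕ)
  | st (s : Stage)
  | mk (p : Fin (R + 1))
  | dg (w : Bool) (p : Fin (R + 1)) (v : Fin 3)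
  | hd (j : Bool)
  | tp (i : Fin (M + 1))
  | tag (a : Letter)

/-- The state set as a sum type. -/
def ptEquiv (R M : ℕ) : Pt R M ≃
    Stage ⊕ Fin (R + 1) ⊕ (Bool × Fin (R + 1) × Fin 3) ⊕ Bool ⊕ Fin (M + 1) ⊕ Letter where
  toFun
    | .st s => .inl s
    | .mk p => .inr (.inl p)
    | .dg w p v => .inr (.inr (.inl (w, p, v)))
    | .hd j => .inr (.inr (.inr (.inl j)))
    | .tp i => .inr (.inr (.inr (.inr (.inl i))))
    | .tag a => .inr (.inr (.inr (.inr (.inr a))))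
  invFun
    | .inl s => .st s
    | .inr (.inl p) => .mk p
    | .inr (.inr (.inl (w, p, v))) => .dg w p v
    | .inr (.inr (.inr (.inl j))) => .hd j
    | .inr (.inr (.inr (.inr (.inl i)))) => .tp i
    | .inr (.inr (.inr (.inr (.inr a)))) => .tag a
  left_inv x := by cases x <;> rfl
  right_inv x := by rcases x with _ | _ | _ | _ | _ | _ <;> rfl

instance (R M : ℕ) : Fintype (Pt R M) := Fintype.ofEquiv _ (ptEquiv R M).symm

theorem card_pt (R M : ℕ) : Fintype.card (Pt R M) = M + 1 + (7 * R + 22) := by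
  rw [Fintype.card_congr (ptEquiv R M)]
  simp only [Fintype.card_sum, Fintype.card_prod, Fintype.card_fin, Fintype.card_bool]
  have h1 : Fintype.card Stage = 5 := rfl
  have h2 : Fintype.card Letter = 8 := rfl
  rw [h1, h2]; ring

/-- Digit increment, undefined at `2`. -/
def incD (v : Fin 3) : Option (Fin 3) := if v = 2 then none else some (v + 1)

section machine

variable {R M : ℕ}

/-- Tape letters on hold cells. -/
def tapHd : Kind → Bool → Option (Pt R M)
  | .k0, j => some (.hd j)
  | .k1, j => some (.hd j)
  | .ra, false => some (.tp (Fin.last M))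
  | .ra, true => some (.hd false)
  | .dr, false => some (.hd true)
  | .dr, true => none

/-- Tape letters on the scanned cell. -/
def tapZero : Kind → Option (Pt R M)
  | .k0 => none
  | .k1 => some (.tp (Fin.last M))
  | .ra => none
  | .dr => some (.hd false)

/-- The action of a letter on states. -/
def act (tgt : Fin (R + 1) → Fin 3) : Letter → Pt R M → Option (Pt R M)
  | a, .tag _ => some (.tag a)
  | .rho, .mk p => some (.mk (p - 1))
  | .rho, .dg w p v => some (.dg w (p - 1) v)
  | .rho, .st s => some (.st s)
  | .rho, .hd j => some (.hd j)
  | .rho, .tp i => some (.tp i)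
  | .car _, .st s => some (.st s)
  | .car _, .hd j => some (.hd j)
  | .car _, .tp i => some (.tp i)
  | .car _, .mk p => if p = 1 then none else some (.mk p)
  | .car w, .dg w' p v =>
      if w' = w ∧ p = 0 then (if v = 2 then some (.dg w' p 0) else none)
      else if w' = w ∧ p = 1 then (incD v).map (.dg w' p)
      else some (.dg w' p v)
  | .tap a, .st s => (ksm a s).map .st
  | .tap _, .mk p => if p = 0 then some (.mk p) else none
  | .tap a, .dg w p v =>
      if w = kin a ∧ p = 0 then (incD v).map (.dg w p) else some (.dg w p v)
  | .tap a, .hd j => tapHd a j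
  | .tap a, .tp i => Fin.cases (tapZero a) (fun j => some (.tp j.castSucc)) i
  | .fin, .st s => if s = .done then some (.st .e0) else none
  | .fin, .mk p => if p = 0 then some (.mk p) else none
  | .fin, .dg w p v => if v = tgt p then some (.dg w p 0) else none
  | .fin, .hd j => some (.hd j)
  | .fin, .tp i => some (.tp i)

/-- Configurations. -/
structure Cfg (R : ℕ) where
  st : Stage
  s : Fin (R + 1)
  d : Bool → Fin (R + 1) → Fin 3
  h0 : Bool
  h1 : Bool
  t : List Bool

/-- The set of states occupied in a configuration. -/
def Cfg.mem (c : Cfg R) : Pt R M → Prop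
  | .st s => s = c.st
  | .mk p => p = c.s
  | .dg w p v => v = c.d w (p - c.s)
  | .hd false => c.h0 = true
  | .hd true => c.h1 = true
  | .tp i => c.t[i.val]? = some true
  | .tag _ => False

/-- When a letter is applicable. -/
def lguard (tgt : Fin (R + 1) → Fin 3) : Letter → Cfg R → Prop
  | .rho, _ => True
  | .car w, c => c.s ≠ 1 ∧ c.d w (-c.s) = 2 ∧ c.d w (-c.s + 1) ≠ 2
  | .tap a, c => c.s = 0 ∧ (ksm a c.st).isSome ∧ c.d (kin a) 0 ≠ 2 ∧
      (kin a = false → c.t.head? ≠ some true) ∧ (a = .dr → c.h1 = false)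
  | .fin, c => c.s = 0 ∧ c.st = .done ∧ ∀ w, c.d w = tgt

/-- The nxt configuration. -/
def nxt : Letter → Cfg R → Cfg R
  | .rho, c => { c with s := c.s - 1 }
  | .car w, c => { c with d := Function.update c.d w (dcarry (c.d w) (-c.s)) }
  | .tap a, c =>
      { c with
        st := (ksm a c.st).getD c.st
        d := Function.update c.d (kin a)
          (Function.update (c.d (kin a)) 0 (c.d (kin a) 0 + 1))
        h0 := kh0 a (c.t.headD false) c.h0 c.h1
        h1 := kh1 a (c.t.headD false) c.h0 c.h1
        t := c.t.tail ++ [kpush a (c.t.headD false) c.h0] }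
  | .fin, c => { c with st := .e0, d := fun _ _ => 0 }

theorem mem_st (c : Cfg R) (s) : c.mem (M := M) (.st s) ↔ s = c.st := Iff.rfl
theorem mem_mk (c : Cfg R) (p) : c.mem (M := M) (.mk p) ↔ p = c.s := Iff.rfl
theorem mem_dg (c : Cfg R) (w p v) : c.mem (M := M) (.dg w p v) ↔ v = c.d w (p - c.s) := Iff.rfl
theorem mem_h0 (c : Cfg R) : c.mem (M := M) (.hd false) ↔ c.h0 = true := Iff.rfl
theorem mem_h1 (c : Cfg R) : c.mem (M := M) (.hd true) ↔ c.h1 = true := Iff.rfl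
theorem mem_tp (c : Cfg R) (i : Fin (M + 1)) : c.mem (.tp i) ↔ c.t[i.val]? = some true := Iff.rfl

theorem guard_of_total (hR : 1 ≤ R) (tgt : Fin (R + 1) → Fin 3) (a : Letter) (c : Cfg R)
    (h : ∀ q : Pt R M, c.mem q → act tgt a q ≠ none) : lguard tgt a c := by
  have h01 : (1 : Fin (R + 1)) ≠ 0 := by
    intro h; have := congrArg Fin.val h; simp at this; omega
  rcases a with _ | w | a | _
  · trivial
  · refine ⟨?_, ?_, ?_⟩
    · have := h (.mk c.s) rfl
      simpa [act] using this
    · have := h (.dg w 0 (c.d w (0 - c.s))) rfl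
      simp [act] at this
      exact this
    · have := h (.dg w 1 (c.d w (1 - c.s))) rfl
      simp [act, h01, incD] at this
      rwa [show -c.s + 1 = 1 - c.s by abel]
  · have hs : c.s = 0 := by
      have := h (.mk c.s) rfl
      simpa [act] using this
    refine ⟨hs, ?_, ?_, ?_, ?_⟩
    · have := h (.st c.st) rfl
      simp [act] at this
      exact Option.isSome_iff_ne_none.2 this
    · have := h (.dg (kin a) 0 (c.d (kin a) (0 - c.s))) rfl
      simpa [act, incD, hs] using this
    · intro hk ht
      refine h (.tp 0) ?_ ?_
      · rw [mem_tp]; rw [List.head?_eq_getElem?] at ht; simpa using ht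
      · cases a <;> simp [kin] at hk <;> simp [act, tapZero]
    · rintro rfl
      by_contra hh
      refine h (.hd true) ?_ rfl
      simpa [mem_h1] using hh
  · have hs : c.s = 0 := by
      have := h (.mk c.s) rfl
      simpa [act] using this
    refine ⟨hs, ?_, ?_⟩
    · have := h (.st c.st) rfl
      simpa [act] using this
    · intro w
      funext i
      have := h (.dg w i (c.d w (i - c.s))) rfl
      simpa [act, hs] using this

/-- Image relation of a partial map between configurations. -/
def Img {α : Type*} (f : α → Option α) (Y Z : α → Prop) : Prop :=
  (∀ y, Y y → ∃ z, Z z ∧ f y = some z) ∧ (∀ z, Z z → ∃ y, Y y ∧ f y = some z)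

theorem next_len (a : Letter) (c : Cfg R) (hl : c.t.length = M + 1) :
    (nxt a c).t.length = M + 1 := by
  rcases a with _ | w | a | _ <;> simp [nxt, hl]

theorem img_next (hR : 1 ≤ R) (tgt : Fin (R + 1) → Fin 3) (a : Letter) (c : Cfg R)
    (hl : c.t.length = M + 1) (hg : lguard tgt a c) :
    Img (act (M := M) tgt a) c.mem (nxt a c).mem := by
  have h01 : (1 : Fin (R + 1)) ≠ 0 := by
    intro h; have := congrArg Fin.val h; simp at this; omega
  rcases a with _ | w | a | _
  · constructor
    · rintro (s | p | ⟨w, p, v⟩ | j | i | b) hy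
      · exact ⟨.st s, hy, rfl⟩
      · exact ⟨.mk (p - 1), by simp only [mem_mk] at *; simp [nxt, hy], rfl⟩
      · exact ⟨.dg w (p - 1) v, by simp only [mem_dg] at *; simp [nxt, hy], rfl⟩
      · exact ⟨.hd j, by cases j <;> exact hy, rfl⟩
      · exact ⟨.tp i, hy, rfl⟩
      · exact hy.elim
    · rintro (s | p | ⟨w, p, v⟩ | j | i | b) hy
      · exact ⟨.st s, hy, rfl⟩
      · exact ⟨.mk (p + 1), by simp only [mem_mk] at *; simp [nxt, hy], by simp [act]⟩
      · refine ⟨.dg w (p + 1) v, ?_, by simp [act]⟩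
        simp only [mem_dg] at *; simp only [hy, nxt]; congr 1; abel
      · exact ⟨.hd j, by cases j <;> exact hy, rfl⟩
      · exact ⟨.tp i, hy, rfl⟩
      · exact hy.elim
  · obtain ⟨g1, g2, g3⟩ := hg
    have hne : -c.s + 1 ≠ -c.s := by simpa using h01
    have e0 : dcarry (c.d w) (-c.s) (-c.s) = 0 := by
      simp [dcarry, Function.update_of_ne hne.symm]
    have e1 : dcarry (c.d w) (-c.s) (-c.s + 1) = c.d w (-c.s + 1) + 1 := by simp [dcarry]
    have e2 : ∀ p, p ≠ 0 → p ≠ 1 → dcarry (c.d w) (-c.s) (p - c.s) = c.d w (p - c.s) := by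
      intro p h0 h1
      unfold dcarry
      rw [Function.update_of_ne, Function.update_of_ne]
      · intro h; apply h0; rw [sub_eq_add_neg] at h; simpa using h
      · intro h; apply h1
        calc p = (p - c.s) + c.s := by abel
          _ = 1 := by rw [h]; abel
    have key : ∀ w' p, act (M := M) tgt (.car w) (.dg w' p (c.d w' (p - c.s))) =
        some (.dg w' p ((nxt (.car w) c).d w' (p - c.s))) := by
      intro w' p
      by_cases hw : w' = w
      · subst hw
        by_cases hp : p = 0
        · subst hp; simp [act, nxt, g2, e0]
        by_cases hp1 : p = 1
        · subst hp1
          rw [show 1 - c.s = -c.s + 1 by abel]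
          simp [act, nxt, h01, incD, g3, e1]
        · simp [act, nxt, hp, hp1, e2 p hp hp1]
      · simp [act, nxt, hw]
    constructor
    · rintro (s | p | ⟨w', p, v⟩ | j | i | b) hy
      · exact ⟨.st s, hy, rfl⟩
      · rw [mem_mk] at hy
        exact ⟨.mk p, hy, by simp [act, hy, g1]⟩
      · rw [mem_dg] at hy
        subst hy
        exact ⟨_, (mem_dg _ _ _ _).2 rfl, key w' p⟩
      · exact ⟨.hd j, by cases j <;> exact hy, rfl⟩
      · exact ⟨.tp i, hy, rfl⟩
      · exact hy.elim
    · rintro (s | p | ⟨w', p, v⟩ | j | i | b) hy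
      · exact ⟨.st s, hy, rfl⟩
      · have hy' : p = c.s := hy
        exact ⟨.mk p, hy', by simp [act, hy', g1]⟩
      · rw [mem_dg] at hy
        subst hy
        exact ⟨_, (mem_dg _ _ _ _).2 rfl, key w' p⟩
      · exact ⟨.hd j, by cases j <;> exact hy, rfl⟩
      · exact ⟨.tp i, hy, rfl⟩
      · exact hy.elim
  · obtain ⟨g1, g2, g3, g4, g5⟩ := hg
    obtain ⟨s', hs'⟩ := Option.isSome_iff_exists.1 g2
    obtain ⟨st, s, d, h0, h1, t⟩ := c
    cases t with
    | nil => simp at hl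
    | cons b l =>
    simp only at g1 g3 g4 g5 hs' hl
    subst g1
    have hl' : l.length = M := by simpa using hl
    have key : ∀ w' p, act (M := M) tgt (.tap a) (.dg w' p (d w' p)) =
        some (.dg w' p ((nxt (.tap a) ⟨st, 0, d, h0, h1, b :: l⟩).d w' p)) := by
      intro w' p
      by_cases hw : w' = kin a
      · subst hw
        by_cases hp : p = 0
        · subst hp; simp [act, nxt, incD, g3]
        · simp [act, nxt, hp]
      · simp [act, nxt, hw]
    constructor
    · rintro (s | p | ⟨w', p, v⟩ | j | i | b') hy
      · have hy' : s = st := hy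
        subst hy'
        exact ⟨.st s', by simp [mem_st, nxt, hs'], by simp [act, hs']⟩
      · have hy' : p = 0 := hy
        subst hy'
        exact ⟨.mk 0, by simp [mem_mk, nxt], by simp [act]⟩
      · rw [mem_dg, sub_zero] at hy
        subst hy
        exact ⟨_, by simp [mem_dg, nxt], key w' p⟩
      · cases j
        · have hy' : h0 = true := hy
          subst hy'
          cases a
          · exact ⟨.hd false, by simp [mem_h0, nxt, kh0], rfl⟩
          · exact ⟨.hd false, by simp [mem_h0, nxt, kh0], rfl⟩
          · exact ⟨.tp (Fin.last M), by simp [mem_tp, nxt, kpush, ← hl'], rfl⟩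
          · exact ⟨.hd true, by simp [mem_h1, nxt, kh1], rfl⟩
        · have hy' : h1 = true := hy
          subst hy'
          cases a
          · exact ⟨.hd true, by simp [mem_h1, nxt, kh1], rfl⟩
          · exact ⟨.hd true, by simp [mem_h1, nxt, kh1], rfl⟩
          · exact ⟨.hd false, by simp [mem_h0, nxt, kh0], rfl⟩
          · simp at g5
      · rw [mem_tp] at hy
        induction i using Fin.cases with
        | zero =>
          simp at hy
          subst hy
          cases a
          · simp [kin] at g4
          · exact ⟨.tp (Fin.last M), by simp [mem_tp, nxt, kpush, ← hl'], rfl⟩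
          · simp [kin] at g4
          · exact ⟨.hd false, by simp [mem_h0, nxt, kh0], rfl⟩
        | succ j =>
          refine ⟨.tp j.castSucc, ?_, by simp [act]⟩
          simp at hy
          have : j.val < l.length := by omega
          simp [mem_tp, nxt, List.getElem?_append_left this, hy]
      · exact hy.elim
    · rintro (s | p | ⟨w', p, v⟩ | j | i | b') hy
      · have hy' : s = s' := by simpa [mem_st, nxt, hs'] using hy
        subst hy'
        exact ⟨.st st, rfl, by simp [act, hs']⟩
      · have hy' : p = 0 := hy
        subst hy'
        exact ⟨.mk 0, rfl, by simp [act]⟩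
      · rw [mem_dg] at hy
        have hy' : v = (nxt (.tap a) ⟨st, 0, d, h0, h1, b :: l⟩).d w' p := by
          simpa [nxt] using hy
        subst hy'
        exact ⟨_, by simp [mem_dg], key w' p⟩
      · cases j
        · have hy' : kh0 a b h0 h1 = true := hy
          cases a <;> simp only [kh0] at hy' <;> subst hy'
          · exact ⟨.hd false, rfl, rfl⟩
          · exact ⟨.hd false, rfl, rfl⟩
          · exact ⟨.hd true, rfl, rfl⟩
          · exact ⟨.tp 0, by simp [mem_tp], rfl⟩
        · have hy' : kh1 a b h0 h1 = true := hy
          cases a <;> simp [kh1] at hy' <;> subst hy'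
          · exact ⟨.hd true, rfl, rfl⟩
          · exact ⟨.hd true, rfl, rfl⟩
          · exact ⟨.hd false, rfl, rfl⟩
      · have hy' : (l ++ [kpush a b h0])[i.val]? = some true := hy
        induction i using Fin.lastCases with
        | last =>
          simp [← hl'] at hy'
          cases a <;> simp [kpush] at hy' <;> subst hy'
          · exact ⟨.tp 0, by simp [mem_tp], rfl⟩
          · exact ⟨.hd false, rfl, rfl⟩
        | cast j =>
          refine ⟨.tp j.succ, ?_, by simp [act]⟩
          have : j.val < l.length := by omega
          rw [Fin.val_castSucc, List.getElem?_append_left this] at hy'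
          simpa [mem_tp] using hy'
      · exact hy.elim
  · obtain ⟨g1, g2, g3⟩ := hg
    constructor
    · rintro (s | p | ⟨w', p, v⟩ | j | i | b) hy
      · have hy' : s = c.st := hy
        exact ⟨.st .e0, rfl, by simp [act, hy', g2]⟩
      · have hy' : p = c.s := hy
        exact ⟨.mk p, hy, by simp [act, hy', g1]⟩
      · rw [mem_dg, g1, sub_zero, g3] at hy
        exact ⟨.dg w' p 0, rfl, by simp [act, hy]⟩
      · exact ⟨.hd j, by cases j <;> exact hy, rfl⟩
      · exact ⟨.tp i, hy, rfl⟩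
      · exact hy.elim
    · rintro (s | p | ⟨w', p, v⟩ | j | i | b) hy
      · have hy' : s = .e0 := hy
        exact ⟨.st .done, g2.symm, by simp [act, hy']⟩
      · have hy' : p = c.s := hy
        exact ⟨.mk p, hy, by simp [act, hy', g1]⟩
      · have hy' : v = 0 := hy
        exact ⟨.dg w' p (tgt p), by simp [mem_dg, g1, g3], by simp [act, hy']⟩
      · exact ⟨.hd j, by cases j <;> exact hy, rfl⟩
      · exact ⟨.tp i, hy, rfl⟩
      · exact hy.elim


/-! ### Runs -/

/-- Runs of the machine on configurations. -/
inductive Run (tgt : Fin (R + 1) → Fin 3) : List Letter → Cfg R → Cfg R → Prop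
  | nil (c) : Run tgt [] c c
  | cons {a u c c'} (hg : lguard tgt a c) (h : Run tgt u (nxt a c) c') : Run tgt (a :: u) c c'

theorem Run.append {tgt : Fin (R + 1) → Fin 3} {u u' c c' c''} (h : Run tgt u c c')
    (h' : Run tgt u' c' c'') : Run tgt (u ++ u') c c'' := by
  induction h with
  | nil => exact h'
  | cons hg h ih => exact Run.cons hg (ih h')

/-- Reachability. -/
def Reach (tgt : Fin (R + 1) → Fin 3) (c c' : Cfg R) : Prop := ∃ u, Run tgt u c c'

theorem Reach.refl (tgt : Fin (R + 1) → Fin 3) (c) : Reach tgt c c := ⟨[], Run.nil c⟩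

theorem Reach.trans {tgt : Fin (R + 1) → Fin 3} {c c' c''} (h : Reach tgt c c')
    (h' : Reach tgt c' c'') : Reach tgt c c'' := by
  obtain ⟨u, hu⟩ := h
  obtain ⟨u', hu'⟩ := h'
  exact ⟨_, hu.append hu'⟩

theorem Reach.single {tgt : Fin (R + 1) → Fin 3} {c} (a) (hg : lguard tgt a c) :
    Reach tgt c (nxt a c) := ⟨[a], Run.cons hg (Run.nil _)⟩

/-- Concrete invariant. -/
def CInv (k v : ℕ) (c : Cfg R) : Prop :=
  c.t.length = 2 * k ∧ AInv k v c.st c.h0 c.h1 (dval (c.d false)) (dval (c.d true)) c.t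

theorem CInv.step {tgt : Fin (R + 1) → Fin 3} {k v : ℕ} (hk : 1 ≤ k) (ht : dval tgt = k)
    {a : Letter} {c : Cfg R}
    (hg : lguard tgt a c) (h : CInv k v c) : CInv k v (nxt a c) := by
  obtain ⟨hl, hI⟩ := h
  rcases a with _ | w | a | _
  · exact ⟨hl, hI⟩
  · refine ⟨hl, ?_⟩
    obtain ⟨g1, g2, g3⟩ := hg
    have hlast : -c.s ≠ Fin.last R := by
      intro h
      apply g1
      have : (-c.s) + 1 = 0 := by rw [h]; exact Fin.last_add_one R
      calc c.s = c.s + (-c.s + 1) := by rw [this, add_zero]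
        _ = 1 := by abel
    have e := dval_carry (c.d w) (-c.s) hlast g2 g3
    cases w <;> simpa [nxt, e] using hI
  · obtain ⟨g1, g2, g3, g4, g5⟩ := hg
    obtain ⟨s', hs'⟩ := Option.isSome_iff_exists.1 g2
    obtain ⟨st, s, d, h0, h1, t⟩ := c
    cases t with
    | nil => simp at hl; omega
    | cons b l =>
    simp only at g1 g3 g4 g5 hs' hl hI
    refine ⟨by simpa [nxt] using hl, ?_⟩
    have := hI.step a hl hs' (by intro h; simpa using g4 h)
    have e := dval_inc _ g3
    cases hka : kin a <;> simp [nxt, hs', hka] at * <;> simpa [e] using this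
  · obtain ⟨g1, g2, g3⟩ := hg
    refine ⟨hl, ?_⟩
    rw [g2, g3, g3, ht] at hI
    have := hI.fin
    simpa [nxt, dval] using this

/-! ### Liveness -/

theorem reach_rot (tgt : Fin (R + 1) → Fin 3) (c : Cfg R) (s' : Fin (R + 1)) :
    Reach tgt c { c with s := s' } := by
  have key : ∀ δ : Fin (R + 1), Reach tgt c { c with s := c.s - δ } := by
    intro δ
    induction δ using Fin.induction with
    | zero => simpa using Reach.refl tgt c
    | succ i ih =>
      refine ih.trans ?_
      have := Reach.single (tgt := tgt) (c := { c with s := c.s - i.castSucc }) .rho trivial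
      simp only [nxt] at this
      rwa [sub_sub, Fin.coeSucc_eq_succ] at this
  have := key (c.s - s')
  simpa using this

theorem reach_carry (tgt : Fin (R + 1) → Fin 3) (c : Cfg R) (w : Bool) (i : Fin R)
    (h2 : c.d w i.castSucc = 2) (h : c.d w i.succ ≠ 2) :
    Reach tgt c { c with d := Function.update c.d w (dcarry (c.d w) i.castSucc) } := by
  refine (reach_rot tgt c (-i.castSucc)).trans ?_
  have g : lguard tgt (.car w) { c with s := -i.castSucc } := by
    refine ⟨?_, ?_, ?_⟩
    · simp only
      intro h
      have h' : i.castSucc + 1 = 0 := by rw [← h]; abel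
      rw [Fin.coeSucc_eq_succ] at h'
      exact Fin.succ_ne_zero i h'
    · simpa using h2
    · simpa [Fin.coeSucc_eq_succ] using h
  refine (Reach.single _ g).trans ?_
  have := reach_rot tgt (nxt (.car w) { c with s := -i.castSucc }) c.s
  simpa [nxt] using this

theorem dsum_update {r : ℕ} (d : Fin r → Fin 3) (i : Fin r) (v : Fin 3) :
    (∑ x, (Function.update d i v x).val) + (d i).val = (∑ x, (d x).val) + v.val := by
  rw [← Finset.add_sum_erase _ _ (Finset.mem_univ i),
    ← Finset.add_sum_erase (a := i) _ (fun i => (d i).val) (Finset.mem_univ i)]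
  have : ∑ x ∈ Finset.univ.erase i, (Function.update d i v x).val =
      ∑ x ∈ Finset.univ.erase i, (d x).val := by
    apply Finset.sum_congr rfl
    intro x hx
    rw [Function.update_of_ne (Finset.ne_of_mem_erase hx)]
  rw [this]; simp; ring

theorem reach_norm (tgt : Fin (R + 1) → Fin 3) (w : Bool) (n : ℕ) : ∀ c : Cfg R,
    (∑ i, (c.d w i).val) = n → dval (c.d w) < 2 ^ (R + 1) →
    ∃ d', (∀ i, d' i ≠ 2) ∧ dval d' = dval (c.d w) ∧
      Reach tgt c { c with d := Function.update c.d w d' } := by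
  induction n using Nat.strong_induction_on with
  | _ n ih =>
  intro c hn hv
  by_cases hall : ∀ i, c.d w i ≠ 2
  · exact ⟨c.d w, hall, rfl, by simpa using Reach.refl tgt c⟩
  push Not at hall
  obtain ⟨i0, hi0⟩ := hall
  obtain ⟨i, hi, hmax⟩ := Finset.exists_max_image (Finset.univ.filter (fun i => c.d w i = 2))
    (fun i => i) ⟨i0, by simp [hi0]⟩
  simp only [Finset.mem_filter, Finset.mem_univ, true_and] at hi hmax
  have hlast : i ≠ Fin.last R := by
    rintro rfl
    have : (c.d w (Fin.last R)).val * 2 ^ (Fin.last R).val ≤ dval (c.d w) :=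
      Finset.single_le_sum (f := fun i => (c.d w i).val * 2 ^ i.val)
        (fun _ _ => Nat.zero_le _) (Finset.mem_univ _)
    rw [hi] at this
    simp [pow_succ] at this hv
    omega
  obtain ⟨j, rfl⟩ := Fin.exists_castSucc_eq.2 hlast
  have hs : c.d w j.succ ≠ 2 := by
    intro h
    have := hmax _ h
    exact absurd this (not_le.2 Fin.castSucc_lt_succ)
  have hr := reach_carry tgt c w j hi hs
  have hs' : c.d w (j.castSucc + 1) ≠ 2 := by rwa [Fin.coeSucc_eq_succ]
  have hdv := dval_carry (c.d w) j.castSucc hlast hi hs'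
  have hsum : (∑ x, (dcarry (c.d w) j.castSucc x).val) < n := by
    have e1 := dsum_update (c.d w) j.castSucc 0
    have e2 := dsum_update (Function.update (c.d w) j.castSucc 0) (j.castSucc + 1)
      (c.d w (j.castSucc + 1) + 1)
    have hne : j.castSucc + 1 ≠ j.castSucc := by
      rw [Fin.coeSucc_eq_succ]; exact Fin.castSucc_lt_succ.ne'
    rw [Function.update_of_ne hne, fin3_inc hs'] at e2
    rw [hi] at e1
    unfold dcarry
    simp at e1
    omega
  obtain ⟨d', h1, h2, h3⟩ := ih _ hsum
    { c with d := Function.update c.d w (dcarry (c.d w) j.castSucc) } (by simp)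
    (by simpa [hdv] using hv)
  refine ⟨d', h1, by simpa [hdv] using h2, hr.trans ?_⟩
  simpa using h3

/-- Normalized configurations. -/
def CNorm (c : Cfg R) : Prop := c.s = 0 ∧ ∀ w i, c.d w i ≠ 2

/-- Honest hold cells. -/
def hs0 : Stage → Bool
  | .r => false
  | _ => true

/-- Honest hold cells. -/
def hs1 : Stage → Bool
  | .d => true
  | _ => false

theorem reach_pass (tgt : Fin (R + 1) → Fin 3) {x y st st'} (h : Tr x y st st') :
    ∀ (c : Cfg R) (y1 : List Bool), CNorm c → c.st = st → c.h0 = hs0 st → c.h1 = hs1 st →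
      c.t = x ++ y1 → (∀ w, dval (c.d w) + x.count w < 2 ^ (R + 1)) →
      ∃ c', Reach tgt c c' ∧ CNorm c' ∧ c'.st = st' ∧ c'.h0 = hs0 st' ∧ c'.h1 = hs1 st' ∧
        c'.t = y1 ++ y ∧ ∀ w, dval (c'.d w) = dval (c.d w) + x.count w := by
  induction h with
  | nil s =>
    intro c y1 hN h1 h2 h3 h4 h5
    exact ⟨c, Reach.refl _ _, hN, h1, h2, h3, by simpa using h4, by simp⟩
  | @cons x y s s1 s' a hs t ih =>
    intro c y1 hN h1 h2 h3 h4 h5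
    have g : lguard tgt (.tap a) c := by
      refine ⟨hN.1, ?_, hN.2 _ _, ?_, ?_⟩
      · rw [h1, hs]; rfl
      · intro hk; simp [h4, hk]
      · rintro rfl
        rw [h3]
        cases s <;> simp [ksm, hs1] at hs ⊢
    have hinc := dval_inc (c.d (kin a)) (hN.2 _ 0)
    have hlt : dval ((nxt (.tap a) c).d (kin a)) < 2 ^ (R + 1) := by
      have := h5 (kin a)
      simp [nxt, hinc] at this ⊢
      omega
    obtain ⟨d', hd1, hd2, hd3⟩ := reach_norm tgt (kin a) _ (nxt (.tap a) c) rfl hlt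
    have hd2' : dval d' = dval (c.d (kin a)) + 1 := by
      rw [hd2]; simp [nxt, hinc]
    have hdd : ∀ w, dval (Function.update (nxt (.tap a) c).d (kin a) d' w) =
        dval (c.d w) + [kin a].count w := by
      intro w
      by_cases hw : w = kin a
      · subst hw; simp [hd2']
      · simp [nxt, hw, Ne.symm hw, List.count_cons]
    have hcnt : ∀ w, (kin a :: x).count w = [kin a].count w + x.count w := by
      intro w; rw [← List.count_append]; rfl
    obtain ⟨c', r1, r2, r3, r4, r5, r6, r7⟩ :=
      ih { nxt (.tap a) c with d := Function.update (nxt (.tap a) c).d (kin a) d' }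
        (y1 ++ [kout a]) (by
          refine ⟨hN.1, ?_⟩
          intro w i
          by_cases hw : w = kin a
          · subst hw; simpa using hd1 i
          · simpa [nxt, hw] using hN.2 w i)
        (by simp [nxt, h1, hs])
        (by
          simp only [nxt, h2, h3, h4]
          cases a <;> cases s <;> simp [ksm] at hs <;> subst hs <;> rfl)
        (by
          simp only [nxt, h2, h3, h4]
          cases a <;> cases s <;> simp [ksm] at hs <;> subst hs <;> rfl)
        (by
          simp only [nxt, h2, h4]
          cases a <;> cases s <;> simp [ksm] at hs <;> subst hs <;>
            simp [kpush, hs0, kout, kin])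
        (by
          intro w
          have := h5 w
          rw [hcnt] at this
          simp only [hdd]
          omega)
    refine ⟨c', ((Reach.single _ g).trans hd3).trans r1, r2, r3, r4, r5, by simp [r6], ?_⟩
    intro w
    rw [r7, hcnt]
    simp only [hdd]
    omega

/-- Configuration at the start of a pass. -/
def cstart (x : List Bool) : Cfg R := ⟨.e0, 0, fun _ _ => 0, true, false, x⟩

theorem reach_start (tgt : Fin (R + 1) → Fin 3) (k : ℕ) (hk : k < 2 ^ (R + 1))
    (ht : dval tgt = k) (ht2 : ∀ i, tgt i ≠ 2) {x y} (h : Tr x y .e0 .done)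
    (hx : ∀ w, x.count w = k) : Reach tgt (cstart x) (cstart y) := by
  have h0 : dval (fun _ : Fin (R + 1) => (0 : Fin 3)) = 0 := by simp [dval]
  obtain ⟨c', r1, r2, r3, r4, r5, r6, r7⟩ := reach_pass tgt h (cstart x) []
    ⟨rfl, by intro w i; simp [cstart]⟩ rfl rfl rfl (by simp [cstart])
    (by intro w; simp [cstart, h0, hx, hk])
  have hd : ∀ w, c'.d w = tgt := by
    intro w
    apply digits_unique _ _ _ (r2.2 w) ht2
    rw [r7, ht, hx]; simp [cstart, h0]
  refine r1.trans ?_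
  have := Reach.single (tgt := tgt) (c := c') .fin ⟨r2.1, r3, hd⟩
  convert this using 1
  simp only [nxt, cstart, r2.1, r4, r5, r6]
  rfl

/-! ### Assembly -/

/-- The action of a word on states. -/
def actW (tgt : Fin (R + 1) → Fin 3) : List Letter → Pt R M → Option (Pt R M)
  | [], p => some p
  | a :: u, p => (act tgt a p).bind (actW tgt u)

theorem actW_append (tgt : Fin (R + 1) → Fin 3) (u u' : List Letter) (p : Pt R M) :
    actW tgt (u ++ u') p = (actW tgt u p).bind (actW tgt u') := by
  induction u generalizing p with
  | nil => rfl
  | cons a u ih =>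
    simp only [List.cons_append, actW]
    cases act tgt a p with
    | none => rfl
    | some q => simpa using ih q

theorem Img.comp {α : Type*} {f g : α → Option α} {X Y Z : α → Prop} (h : Img f X Y)
    (h' : Img g Y Z) : Img (fun x => (f x).bind g) X Z := by
  constructor
  · intro x hx
    obtain ⟨y, hy, e⟩ := h.1 x hx
    obtain ⟨z, hz, e'⟩ := h'.1 y hy
    exact ⟨z, hz, by simp [e, e']⟩
  · intro z hz
    obtain ⟨y, hy, e'⟩ := h'.2 z hz
    obtain ⟨x, hx, e⟩ := h.2 y hy
    exact ⟨x, hx, by simp [e, e']⟩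

theorem Img.cancel {α : Type*} {f g : α → Option α} {X Y Z : α → Prop} (h : Img f X Y)
    (h' : Img (fun x => (f x).bind g) X Z) : Img g Y Z := by
  constructor
  · intro y hy
    obtain ⟨x, hx, e⟩ := h.2 y hy
    obtain ⟨z, hz, e'⟩ := h'.1 x hx
    exact ⟨z, hz, by simpa [e] using e'⟩
  · intro z hz
    obtain ⟨x, hx, e'⟩ := h'.2 z hz
    obtain ⟨y, hy, e⟩ := h.1 x hx
    exact ⟨y, hy, by simpa [e] using e'⟩

theorem Run.img (hR : 1 ≤ R) {tgt : Fin (R + 1) → Fin 3} {u c c'} (h : Run tgt u c c') :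
    c.t.length = M + 1 → Img (actW (M := M) tgt u) c.mem c'.mem := by
  induction h with
  | nil c => exact fun _ => ⟨fun y hy => ⟨y, hy, rfl⟩, fun y hy => ⟨y, hy, rfl⟩⟩
  | cons hg h ih =>
    intro hl
    exact (img_next hR tgt _ _ hl hg).comp (ih (next_len _ _ hl))

theorem soundness (hR : 1 ≤ R) {tgt : Fin (R + 1) → Fin 3} {k v : ℕ} (hk : 1 ≤ k)
    (ht : dval tgt = k) (Z : Pt R M → Prop) (u : List Letter) :
    ∀ c : Cfg R, c.t.length = M + 1 → CInv k v c → Img (actW (M := M) tgt u) c.mem Z →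
      ∃ c' : Cfg R, c'.t.length = M + 1 ∧ CInv k v c' ∧ ∀ p, Z p ↔ c'.mem p := by
  induction u with
  | nil =>
    intro c hl hc hi
    refine ⟨c, hl, hc, fun p => ⟨fun hp => ?_, fun hp => ?_⟩⟩
    · obtain ⟨y, hy, e⟩ := hi.2 p hp
      simp only [actW, Option.some.injEq] at e
      exact e ▸ hy
    · obtain ⟨y, hy, e⟩ := hi.1 p hp
      simp only [actW, Option.some.injEq] at e
      exact e ▸ hy
  | cons a u ih =>
    intro c hl hc hi
    have hg : lguard tgt a c := by
      refine guard_of_total (M := M) hR tgt a c fun q hq hn => ?_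
      obtain ⟨z, _, e⟩ := hi.1 q hq
      simp [actW, hn] at e
    exact ih _ (next_len _ _ hl) (hc.step hk ht hg) ((img_next hR tgt a c hl hg).cancel hi)

theorem start_of_mem {k v : ℕ} {c : Cfg R} {x : List Bool} (hl : c.t.length = M + 1)
    (hx : x.length = M + 1) (hk : x.count true = k) (hc : CInv k v c)
    (h : ∀ p : Pt R M, (cstart (R := R) x).mem p ↔ c.mem p) : v ≤ gval false x := by
  obtain ⟨h2, hI⟩ := hc
  have h1 : Stage.e0 = c.st := by
    rw [← mem_st (M := M), ← h, mem_st]; rfl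
  have hs : 0 = c.s := by
    rw [← mem_mk (M := M), ← h, mem_mk]; rfl
  have hd : ∀ w, dval (c.d w) = 0 := by
    intro w
    have : c.d w = fun _ => 0 := by
      funext p
      have := (h (.dg w p 0)).1 (by rw [mem_dg]; rfl)
      rw [mem_dg, ← hs, sub_zero] at this
      exact this.symm
    rw [this]; simp [dval]
  have htt : c.t = x := by
    apply List.ext_getElem (by omega)
    intro i hi hi'
    have := h (.tp ⟨i, by omega⟩)
    rw [mem_tp, mem_tp] at this
    have e : (cstart (R := R) x).t = x := rfl
    rw [e] at this
    simp only [List.getElem?_eq_getElem hi, List.getElem?_eq_getElem hi', Option.some.injEq] at this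
    exact (Bool.eq_iff_iff.2 this).symm
  rw [hd, hd, ← h1, htt] at hI
  exact hI.start_val (by rw [← htt]; exact h2) hk

/-- The letters as partial transformations of `Fin n`. -/
def trf {n : ℕ} (e : Pt R M ≃ Fin n) (tgt : Fin (R + 1) → Fin 3) (a : Letter) (i : Fin n) :
    Option (Fin n) := (act tgt a (e.symm i)).map e

theorem trf_inj {n : ℕ} (e : Pt R M ≃ Fin n) (tgt : Fin (R + 1) → Fin 3) :
    Function.Injective (trf e tgt) := by
  intro a b h
  have := congrFun h (e (.tag .rho))
  simpa [trf, act] using this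

theorem foldl_bind_none {n : ℕ} (u : List (Fin n → Option (Fin n))) :
    u.foldl (fun o f => o.bind f) none = none := by
  induction u with
  | nil => rfl
  | cons f u ih => simpa using ih

theorem ptApply_map {n : ℕ} (e : Pt R M ≃ Fin n) (tgt : Fin (R + 1) → Fin 3) (u : List Letter) :
    ∀ p, ptApply (u.map (trf e tgt)) (e p) = (actW tgt u p).map e := by
  induction u with
  | nil => intro p; rfl
  | cons a u ih =>
    intro p
    simp only [ptApply] at ih
    simp only [ptApply, actW, List.map_cons, List.foldl_cons, Option.bind_some]
    have : trf e tgt a (e p) = (act tgt a p).map e := by simp [trf]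
    rw [this]
    cases act tgt a p with
    | none => simpa using foldl_bind_none _
    | some q => simpa using ih q

theorem exists_words (tgt : Fin (R + 1) → Fin 3) (N : ℕ) (x : ℕ → List Bool)
    (h : ∀ i, i + 1 < N → Reach tgt (cstart (x i)) (cstart (x (i + 1)))) :
    ∃ ws : Fin N → List Letter, ∀ j, j < N →
      Run tgt (((List.ofFn ws).take (j + 1)).flatten) (cstart (x 0)) (cstart (x j)) := by
  have key : ∀ i, ∃ u, i + 1 < N → Run tgt u (cstart (x i)) (cstart (x (i + 1))) := by
    intro i
    by_cases hi : i + 1 < N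
    · obtain ⟨u, hu⟩ := h i hi
      exact ⟨u, fun _ => hu⟩
    · exact ⟨[], fun h => absurd h hi⟩
  choose g hg using key
  let W : ℕ → List Letter := fun i => match i with
    | 0 => []
    | i + 1 => g i
  refine ⟨fun i => W i, fun j => ?_⟩
  induction j with
  | zero =>
    intro hj
    have : (List.ofFn fun i : Fin N => W i).take 1 = [W 0] := by
      rw [List.take_one]
      cases N with
      | zero => omega
      | succ N => simp
    rw [this]
    exact Run.nil _
  | succ j ih =>
    intro hj
    rw [List.take_add_one]
    have : (List.ofFn fun i : Fin N => W i)[j + 1]? = some (g j) := by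
      simp [hj, W]
    rw [this]
    simp only [List.flatten_append]
    refine (ih (by omega)).append ?_
    simpa using hg j hj


end machine


theorem main_aux (k : ℕ) (hk : 1 ≤ k) (R M : ℕ) (hR : 1 ≤ R) (hM : M + 1 = 2 * k)
    (hkR : k < 2 ^ (R + 1)) (n : ℕ) (e : Pt R M ≃ Fin n) :
        ∃ A : Finset (Fin n → Option (Fin n)),
          A.card = 8 ∧
          ∃ ws : Fin (Nat.choose (2 * k) k) → List (Fin n → Option (Fin n)),
            (∀ i, ∀ g ∈ ws i, g ∈ A) ∧
            ∀ h h' : ℕ, 1 ≤ h' → h' < h → h ≤ Nat.choose (2 * k) k →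
              ∀ u : List (Fin n → Option (Fin n)), (∀ g ∈ u, g ∈ A) →
                (fun q => ptApply ((((List.ofFn ws).take h).flatten) ++ u) q) ≠
                  (fun q => ptApply (((List.ofFn ws).take h').flatten) q) := by
  classical
  obtain ⟨tgt, ht2, ht⟩ := exists_digits (R + 1) k hkR
  obtain ⟨L, hLl, hLc, hch, -, -⟩ := (revolving k k).1
  rw [← two_mul] at hLl
  set x : ℕ → List Bool := fun i => L.getD i [] with hx
  have hxg : ∀ i (hi : i < L.length), x i = L[i] := by
    intro i hi; simp [hx, hi]
  have hxc : ∀ i, i < L.length → ∀ w, (x i).count w = k := by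
    intro i hi w
    have := hLc (x i) (by rw [hxg i hi]; exact List.getElem_mem hi)
    cases w
    · exact this.1
    · exact this.2
  have hxl : ∀ i, i < L.length → (x i).length = 2 * k := by
    intro i hi
    have h1 := hxc i hi true
    have h2 := hxc i hi false
    have := List.count_not_add_count (x i) true
    simp only [Bool.not_true] at this
    omega
  have hT : ∀ i, i + 1 < L.length → Tr (x i) (x (i + 1)) .e0 .done := by
    intro i hi
    rw [hxg i (by omega), hxg (i + 1) hi]
    exact List.isChain_iff_getElem.1 hch i hi
  have hmono : ∀ j i, i < j → j < L.length → gval false (x i) < gval false (x j) := by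
    intro j
    induction j with
    | zero => intro i hi; omega
    | succ j ih =>
      intro i hi hj
      have h1 := (hT j hj).gval_lt false rfl rfl
      rcases Nat.lt_succ_iff_lt_or_eq.1 hi with h | rfl
      · exact (ih i h (by omega)).trans h1
      · exact h1
  obtain ⟨ws, hws⟩ := exists_words tgt (Nat.choose (2 * k) k) x (by
    intro i hi
    exact reach_start tgt k hkR ht ht2 (hT i (by omega)) (hxc i (by omega)))
  refine ⟨Finset.univ.image (trf e tgt), ?_, fun i => (ws i).map (trf e tgt), ?_, ?_⟩
  · rw [Finset.card_image_of_injective _ (trf_inj e tgt)]; rfl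
  · intro i g hg
    obtain ⟨a, _, rfl⟩ := List.mem_map.1 hg
    exact Finset.mem_image_of_mem _ (Finset.mem_univ a)
  · intro h h' h1 hlt hle u hu heq
    have hu' : ∃ u' : List Letter, u = u'.map (trf e tgt) := by
      have : u ∈ Set.range (List.map (trf e tgt)) := by
        rw [Set.range_list_map]
        intro g hg
        obtain ⟨a, _, ha⟩ := Finset.mem_image.1 (hu g hg)
        exact ⟨a, ha⟩
      obtain ⟨u', hu'⟩ := this
      exact ⟨u', hu'.symm⟩
    obtain ⟨u', rfl⟩ := hu'
    have hof : (List.ofFn fun i => (ws i).map (trf e tgt)) =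
        (List.ofFn ws).map (List.map (trf e tgt)) := by
      rw [List.map_ofFn]; rfl
    obtain ⟨h, rfl⟩ : ∃ j, h = j + 1 := ⟨h - 1, by omega⟩
    obtain ⟨h', rfl⟩ : ∃ j, h' = j + 1 := ⟨h' - 1, by omega⟩
    have hfl : ∀ j, ((List.ofFn fun i => (ws i).map (trf e tgt)).take j).flatten =
        (((List.ofFn ws).take j).flatten).map (trf e tgt) := by
      intro j
      rw [hof, ← List.map_take, List.map_flatten]
    simp only [hfl, ← List.map_append] at heq
    have hW : actW (M := M) tgt (((List.ofFn ws).take (h + 1)).flatten ++ u') =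
        actW tgt (((List.ofFn ws).take (h' + 1)).flatten) := by
      funext p
      have := congrFun heq (e p)
      simp only [ptApply_map] at this
      exact Option.map_injective e.injective this
    have i1 := (hws h (by omega)).img (M := M) hR (by
      rw [hM]; exact hxl 0 (by omega))
    have i2 := (hws h' (by omega)).img (M := M) hR (by
      rw [hM]; exact hxl 0 (by omega))
    rw [← hW] at i2
    have hap : actW (M := M) tgt (((List.ofFn ws).take (h + 1)).flatten ++ u') = fun p =>
        (actW tgt (((List.ofFn ws).take (h + 1)).flatten) p).bind (actW tgt u') := by
      funext p; exact actW_append _ _ _ _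
    rw [hap] at i2
    have i3 := i1.cancel i2
    have hlh := hxl h (by omega)
    have hlh' := hxl h' (by omega)
    have hinv : CInv (R := R) k (gval false (x h)) (cstart (x h)) := by
      refine ⟨hlh, ?_⟩
      have := AInv.start hlh (hxc h (by omega) true)
      simpa [cstart, dval] using this
    obtain ⟨c', hl', hc', hmem⟩ := soundness hR hk ht _ u' _ (by rw [hM]; exact hlh) hinv i3
    have := start_of_mem hl' (by rw [hM]; exact hlh') (hxc h' (by omega) true) hc' hmem
    have := hmono h h' (by omega) (by omega)
    omega


/-- There exist constants `m` and `C` such that for every `k ≥ 1` there are a state set of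
size `n ≤ 2k + C·(log₂(2k + 1) + 1)`, an alphabet `A` of `m` partial transformations of it,
and words `w₁, …, w_ℓ` over `A` with `ℓ = (2k choose k)` such that for all `1 ≤ h' < h ≤ ℓ`
and every word `u` over `A`, the partial transformation expressed by `w₁ ⋯ w_h u` differs
from the one expressed by `w₁ ⋯ w_h'` (yielding a chain of `R`-classes of length
`(2k choose k)`). -/
theorem long_chain_of_R_classes :
    ∃ m C : ℕ, ∀ k : ℕ, 1 ≤ k →
      ∃ n : ℕ, n ≤ 2 * k + C * (Nat.log 2 (2 * k + 1) + 1) ∧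
        ∃ A : Finset (Fin n → Option (Fin n)),
          A.card = m ∧
          ∃ ws : Fin (Nat.choose (2 * k) k) → List (Fin n → Option (Fin n)),
            (∀ i, ∀ g ∈ ws i, g ∈ A) ∧
            ∀ h h' : ℕ, 1 ≤ h' → h' < h → h ≤ Nat.choose (2 * k) k →
              ∀ u : List (Fin n → Option (Fin n)), (∀ g ∈ u, g ∈ A) →
                (fun q => ptApply ((((List.ofFn ws).take h).flatten) ++ u) q) ≠
                  (fun q => ptApply (((List.ofFn ws).take h').flatten) q) := by
  refine ⟨8, 22, fun k hk => ?_⟩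
  have hR : 1 ≤ Nat.log 2 (2 * k + 1) := Nat.log_pos (by norm_num) (by omega)
  have hlog : 2 * k + 1 < 2 ^ (Nat.log 2 (2 * k + 1) + 1) :=
    Nat.lt_pow_succ_log_self (by norm_num) _
  generalize Nat.log 2 (2 * k + 1) = R at hR hlog
  refine ⟨2 * k - 1 + 1 + (7 * R + 22), by omega, ?_⟩
  exact main_aux k hk R (2 * k - 1) hR (by omega) (by omega) _
    (Fintype.equivFinOfCardEq (card_pt R (2 * k - 1)))
end
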